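/- arXiv:2504.05405 — 3 statements merged into one kernel-verified Lean document; each statement's English description precedes it below -/
import Mathlib

section
/- Exponential error amplification of PSDP without policy completeness (lower bound against PSDP with a worst-case oracle): For every integer H ≥ 2, every real C_push ≥ 5H, and every ε_stat ∈ (0, C_push^{−H}], there exist: a finite-horizon layered MDP M with horizon H+1, at most 1 + H·(2H+3) states, and at most H+2 actions; a policy class Π consisting of open-loop policies, with |Π| ≤ (H+2)·2^{H}, containing an optimal policy π⋆ and closed under layerwise recombination (Π̄ = Π); reset distributions μ = (μ_1, …, μ_{H+1}) that are admissible and satisfy pushforward concentrability with parameter C_push; and per-layer selections π̂_h ∈ Π_h for h = H+1, …, 1, each satisfying the ε_stat-approximate policy optimization condition (CB_h) with rollout π̂_{h+1:H+1}, such that the composite policy π̂ := π̂_{1:H+1} satisfies V^{π⋆} − V^{π̂} ≥ (C_push/2)^{H−1}·ε_stat. -/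
open Finset

/-- A finite-horizon layered MDP: a finite state space partitioned into layers
`1, …, H`, a finite action set, layer-respecting transitions, mean rewards in `[0,1]`,
and an initial distribution supported on layer `1`. -/
structure LayeredMDP (X A : Type) [Fintype X] [Fintype A] (H : ℕ) where
  layer : X → ℕ
  layer_lb : ∀ x, 1 ≤ layer x
  layer_ub : ∀ x, layer x ≤ H
  layer_surj : ∀ h, 1 ≤ h → h ≤ H → ∃ x, layer x = h
  P : X → A → X → ℝ
  P_nonneg : ∀ x a x', 0 ≤ P x a x'
  P_sum_one : ∀ x a, layer x < H → ∑ x', P x a x' = 1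
  P_supp : ∀ x a x', layer x < H → P x a x' ≠ 0 → layer x' = layer x + 1
  R : X → A → ℝ
  R_nonneg : ∀ x a, 0 ≤ R x a
  R_le_one : ∀ x a, R x a ≤ 1
  d1 : X → ℝ
  d1_nonneg : ∀ x, 0 ≤ d1 x
  d1_sum_one : ∑ x, d1 x = 1
  d1_supp : ∀ x, d1 x ≠ 0 → layer x = 1

namespace LayeredMDP

variable {X A : Type} [Fintype X] [Fintype A] {H : ℕ}

/-- `n`-step value function of policy `π` (backward recursion). -/
noncomputable def Vsteps (M : LayeredMDP X A H) (π : X → A) : ℕ → X → ℝ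
  | 0, _ => 0
  | n + 1, x => M.R x (π x) + ∑ x', M.P x (π x) x' * Vsteps M π n x'

/-- The value `V^π(x)` of policy `π` from state `x` (at layer `M.layer x`). -/
noncomputable def V (M : LayeredMDP X A H) (π : X → A) (x : X) : ℝ :=
  Vsteps M π (H + 1 - M.layer x) x

/-- `Q^π(x,a)`: for `x` in layer `H` this is `R(x,a)`, and for earlier layers it is
`R(x,a) + E_{x' ∼ P(·|x,a)} V^π(x')`.  Note that `Q^π(x,a)` depends on `π` only
through its actions at layers after `M.layer x`, so it also serves as the
`Q`-function of a partial policy on layers `M.layer x + 1, …, H`. -/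
noncomputable def Q (M : LayeredMDP X A H) (π : X → A) (x : X) (a : A) : ℝ :=
  M.R x a + ∑ x', M.P x a x' * Vsteps M π (H - M.layer x) x'

/-- The value `V^π = E_{x ∼ d1} V^π(x)` of a policy. -/
noncomputable def value (M : LayeredMDP X A H) (π : X → A) : ℝ :=
  ∑ x, M.d1 x * M.V π x

noncomputable def occAux (M : LayeredMDP X A H) (π : X → A) : ℕ → X → ℝ
  | 0 => M.d1
  | n + 1 => fun x' => ∑ x, occAux M π n x * M.P x (π x) x'

/-- Occupancy measure `d^π_h` at layer `h ∈ {1, …, H}`. -/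
noncomputable def occ (M : LayeredMDP X A H) (π : X → A) (h : ℕ) : X → ℝ :=
  occAux M π (h - 1)

/-- `πs` is an optimal policy: it maximizes the value from every state simultaneously. -/
def IsOptimal (M : LayeredMDP X A H) (πs : X → A) : Prop :=
  ∀ (x : X) (π : X → A), M.V π x ≤ M.V πs x

/-- `μ = (μ_1, …, μ_H)` is a family of reset distributions: each `μ_h` is a
probability distribution supported on layer `h`. -/
def IsReset (M : LayeredMDP X A H) (μ : ℕ → X → ℝ) : Prop :=
  (∀ h x, 0 ≤ μ h x) ∧ (∀ h, 1 ≤ h → h ≤ H → ∑ x, μ h x = 1) ∧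
    (∀ h x, 1 ≤ h → h ≤ H → μ h x ≠ 0 → M.layer x = h)

/-- `σ` belongs to `Π_h`, the set of restrictions of members of `Π` to layer `h`. -/
def memLayer (M : LayeredMDP X A H) (Pi : Finset (X → A)) (h : ℕ) (σ : X → A) : Prop :=
  ∃ π ∈ Pi, ∀ x, M.layer x = h → σ x = π x

/-- `π` belongs to `Π̄`, the layerwise product closure of `Π`. -/
def inClosure (M : LayeredMDP X A H) (Pi : Finset (X → A)) (π : X → A) : Prop :=
  ∀ h, 1 ≤ h → h ≤ H → M.memLayer Pi h π

/-- Average policy completeness error of the rollout `ρ` (standing for a partial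
policy `π̂_{h+1:H}`) with respect to a distribution `ν` on layer `h`:
`ε_PC(ρ, ν) = min_{π ∈ Π} E_{x∼ν}[max_a Q^ρ(x,a) − Q^ρ(x, π(x))]`. -/
noncomputable def epsPC [Nonempty A] (M : LayeredMDP X A H) (Pi : Finset (X → A))
    (hPi : Pi.Nonempty) (ν : X → ℝ) (ρ : X → A) : ℝ :=
  Pi.inf' hPi fun π =>
    ∑ x, ν x * ((univ.sup' univ_nonempty fun a => M.Q ρ x a) - M.Q ρ x (π x))

/-- The `ε_stat`-approximate policy optimization condition `(CB_h)`: the selection `σ`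
is an `ε_stat`-approximate maximizer of `π ↦ E_{x∼ν}[Q^ρ(x, π(x))]` over `Π`,
where `ρ` is the rollout (partial policy `π̂_{h+1:H}`). -/
def CB (M : LayeredMDP X A H) (Pi : Finset (X → A)) (ν : X → ℝ) (εstat : ℝ)
    (ρ σ : X → A) : Prop :=
  ∀ π ∈ Pi, (∑ x, ν x * M.Q ρ x (π x)) - εstat ≤ ∑ x, ν x * M.Q ρ x (σ x)

/-- `ν` is admissible at layer `h`: it is a mixture of occupancy measures `d^π_h`
of policies `π ∈ Π̄`. -/
def Admissible [DecidableEq X] (M : LayeredMDP X A H) (Pi : Finset (X → A)) (h : ℕ)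
    (ν : X → ℝ) : Prop :=
  ∃ w : (X → A) → ℝ, (∀ π, 0 ≤ w π) ∧ (∑ π, w π = 1) ∧
    (∀ π, w π ≠ 0 → M.inClosure Pi π) ∧ (∀ x, ν x = ∑ π, w π * M.occ π h x)

end LayeredMDP

namespace PSDPLB

noncomputable def D (H : ℕ) (C ε : ℝ) (h : ℕ) : ℝ :=
  if h ≤ H + 1 then 2 * (C / 2) ^ (H + 1 - h) * ε else 0

def nx (v a : ℕ) : ℕ := 2 * (v / 2 + 1) + (if v % 2 = 0 then 1 else if a = 0 then 0 else 1)

noncomputable def rew (H : ℕ) (C ε : ℝ) (v a : ℕ) : ℝ :=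
  if v % 2 = 0 then (if a = 0 then D H C ε (v / 2 + 1) - D H C ε (v / 2 + 3) else 0)
  else if a = 0 then 0 else if v = 1 then 0 else D H C ε (v / 2 + 2) - D H C ε (v / 2 + 3)

noncomputable def Ws (H : ℕ) (C ε : ℝ) (v : ℕ) : ℝ :=
  if v % 2 = 0 then D H C ε (v / 2 + 1) else D H C ε (v / 2 + 2)

noncomputable def Wh (H : ℕ) (C ε : ℝ) (v : ℕ) : ℝ :=
  if v % 2 = 0 then D H C ε (v / 2 + 3)
  else if v = 1 then D H C ε 3 else D H C ε (v / 2 + 2)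

section
variable {H : ℕ} {C ε : ℝ}

lemma D_big {h : ℕ} (hh : H + 1 < h) : D H C ε h = 0 := by
  unfold D; rw [if_neg (by omega)]

lemma D_last : D H C ε (H + 1) = 2 * ε := by simp [D]

lemma D_step {h : ℕ} (hh : h ≤ H) : D H C ε h = C / 2 * D H C ε (h + 1) := by
  unfold D
  rw [if_pos (by omega), if_pos (by omega), show H + 1 - h = (H + 1 - (h + 1)) + 1 by omega,
    pow_succ]
  ring

lemma D_nonneg (hC : 10 ≤ C) (hε : 0 < ε) (h : ℕ) : 0 ≤ D H C ε h := by
  unfold D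
  split_ifs
  · positivity
  · exact le_rfl

lemma D_five (hC : 10 ≤ C) (hε : 0 < ε) (h : ℕ) : 5 * D H C ε (h + 1) ≤ D H C ε h := by
  by_cases hh : h ≤ H
  · rw [D_step hh]
    have := D_nonneg (H := H) hC hε (h + 1)
    nlinarith
  · rw [D_big (h := h + 1) (by omega)]
    have := D_nonneg (H := H) hC hε h
    linarith

lemma D_le_one (hH : 2 ≤ H) (hC : 10 ≤ C) (hε : 0 < ε) (hε1 : ε ≤ (C ^ H)⁻¹) {h : ℕ}
    (hh : 1 ≤ h) : D H C ε h ≤ 1 := by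
  have h1 : D H C ε 1 ≤ 1 := by
    unfold D
    rw [if_pos (by omega), show H + 1 - 1 = H by omega, div_pow]
    have hp : 0 < C ^ H := by positivity
    have h2 : (2 : ℝ) ≤ 2 ^ H := by
      calc (2 : ℝ) = 2 ^ 1 := by norm_num
        _ ≤ 2 ^ H := pow_le_pow_right₀ (by norm_num) (by omega)
    have h3 : C ^ H * ε ≤ 1 := by
      calc C ^ H * ε ≤ C ^ H * (C ^ H)⁻¹ := by gcongr
        _ = 1 := mul_inv_cancel₀ hp.ne'
    have h4 : 2 * (C ^ H / 2 ^ H) * ε = (2 / 2 ^ H) * (C ^ H * ε) := by ring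
    rw [h4]
    have h5 : (2 : ℝ) / 2 ^ H ≤ 1 := by rw [div_le_one (by positivity)]; exact h2
    have : 0 ≤ C ^ H * ε := by positivity
    calc (2 : ℝ) / 2 ^ H * (C ^ H * ε) ≤ 1 * 1 := by gcongr
      _ = 1 := by norm_num
  have : Antitone (D H C ε) := antitone_nat_of_succ_le fun n => by
    have := D_five (H := H) hC hε n
    have := D_nonneg (H := H) hC hε (n + 1)
    linarith
  exact (this hh).trans h1

lemma nx_div (v a : ℕ) : nx v a / 2 = v / 2 + 1 := by unfold nx; split_ifs <;> omega

lemma rew_bounds (hH : 2 ≤ H) (hC : 10 ≤ C) (hε : 0 < ε) (hε1 : ε ≤ (C ^ H)⁻¹) (v a : ℕ) :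
    0 ≤ rew H C ε v a ∧ rew H C ε v a ≤ 1 := by
  have a0 := D_le_one hH hC hε hε1 (h := v / 2 + 1) (by omega)
  have a1 := D_five (H := H) hC hε (v / 2 + 1)
  have a2 := D_five (H := H) hC hε (v / 2 + 2)
  have a3 := D_nonneg (H := H) hC hε (v / 2 + 3)
  simp only [add_assoc, Nat.reduceAdd] at a1 a2
  unfold rew
  split_ifs <;> constructor <;> linarith

lemma bell_le (hC : 10 ≤ C) (hε : 0 < ε) (v a : ℕ) :
    rew H C ε v a + Ws H C ε (nx v a) ≤ Ws H C ε v := by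
  have a1 := D_five (H := H) hC hε (v / 2 + 1)
  have a2 := D_five (H := H) hC hε (v / 2 + 2)
  have a3 := D_nonneg (H := H) hC hε (v / 2 + 3)
  simp only [add_assoc, Nat.reduceAdd] at a1 a2
  have hd := nx_div v a
  unfold Ws
  rw [hd]
  unfold rew nx
  simp only [add_assoc, Nat.reduceAdd]
  split_ifs <;> first | omega | linarith

lemma bell_eq (v : ℕ) :
    rew H C ε v 0 + Ws H C ε (nx v 0) = Ws H C ε v := by
  have hd := nx_div v 0
  unfold Ws
  rw [hd]
  unfold rew nx
  simp only [add_assoc, Nat.reduceAdd]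
  split_ifs <;> first | omega | (exfalso; omega) | linarith

lemma bellh_eq (v : ℕ) :
    rew H C ε v 1 + Wh H C ε (nx v 1) = Wh H C ε v := by
  have hd := nx_div v 1
  unfold Wh
  rw [hd]
  by_cases h1 : v = 1
  · subst h1; simp [rew, nx]
  unfold rew nx
  simp only [add_assoc, Nat.reduceAdd]
  split_ifs <;> first | omega | (exfalso; omega) | linarith

lemma Ws_big {v : ℕ} (hv : 2 * (H + 1) ≤ v) : Ws H C ε v = 0 := by
  unfold Ws
  rw [D_big (h := v / 2 + 1) (by omega), D_big (h := v / 2 + 2) (by omega), ite_self]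

lemma Wh_big {v : ℕ} (hH : 2 ≤ H) (hv : 2 * (H + 1) ≤ v) : Wh H C ε v = 0 := by
  unfold Wh
  rw [D_big (h := v / 2 + 3) (by omega), D_big (h := v / 2 + 2) (by omega),
    if_neg (show v ≠ 1 by omega), ite_self]

end

noncomputable def PP (N : ℕ) (x : Fin N) (a : Fin 2) (x' : Fin N) : ℝ :=
  if x'.val = nx x.val a.val then 1 else 0

lemma sum_ind {N k : ℕ} (hk : k < N) (g : Fin N → ℝ) :
    ∑ x : Fin N, (if x.val = k then (1 : ℝ) else 0) * g x = g ⟨k, hk⟩ := by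
  rw [Finset.sum_eq_single (⟨k, hk⟩ : Fin N)]
  · simp
  · intro b _ hb
    rw [if_neg (fun h => hb (Fin.ext h)), zero_mul]
  · simp

lemma sum_ind_big {N k : ℕ} (hk : N ≤ k) (g : Fin N → ℝ) :
    ∑ x : Fin N, (if x.val = k then (1 : ℝ) else 0) * g x = 0 := by
  apply Finset.sum_eq_zero
  intro b _
  rw [if_neg (by omega), zero_mul]

noncomputable def MM (H : ℕ) (C ε : ℝ) (hH : 2 ≤ H) (hC : 10 ≤ C) (hε : 0 < ε)
    (hε1 : ε ≤ (C ^ H)⁻¹) : LayeredMDP (Fin (2 * (H + 1))) (Fin 2) (H + 1) where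
  layer x := x.val / 2 + 1
  layer_lb x := by omega
  layer_ub x := by have := x.2; omega
  layer_surj h h1 h2 := ⟨⟨2 * (h - 1), by omega⟩, by simp; omega⟩
  P := PP _
  P_nonneg x a x' := by unfold PP; split_ifs <;> norm_num
  P_sum_one x a hx := by
    have := nx_div x.val a.val
    have := sum_ind (N := 2 * (H + 1)) (k := nx x.val a.val) (by omega) (fun _ => 1)
    simpa [PP] using this
  P_supp x a x' hx h := by
    unfold PP at h
    have h' : x'.val = nx x.val a.val := by
      by_contra h'
      exact h (if_neg h')
    rw [h', nx_div]
  R x a := rew H C ε x.val a.val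
  R_nonneg x a := (rew_bounds hH hC hε hε1 _ _).1
  R_le_one x a := (rew_bounds hH hC hε hε1 _ _).2
  d1 x := if x.val = 1 then 1 else 0
  d1_nonneg x := by split_ifs <;> norm_num
  d1_sum_one := by
    have := sum_ind (N := 2 * (H + 1)) (k := 1) (by omega) (fun _ => 1)
    simpa using this
  d1_supp x h := by
    have h' : x.val = 1 := by
      by_contra h'
      exact h (if_neg h')
    rw [h']

noncomputable def PiC (H : ℕ) : Finset (Fin (2 * (H + 1)) → Fin 2) :=
  (Finset.univ : Finset (Fin (H + 1) → Fin 2)).image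
    (fun f x => f ⟨x.val / 2, by have := x.2; omega⟩)

noncomputable def al (C : ℝ) (h : ℕ) : ℝ := if h = 1 then 0 else C⁻¹

noncomputable def mu (C : ℝ) (N : ℕ) (h : ℕ) (x : Fin N) : ℝ :=
  al C h * (if x.val = 2 * (h - 1) then 1 else 0)
    + (1 - al C h) * (if x.val = 2 * (h - 1) + 1 then 1 else 0)

lemma sum_mu {C : ℝ} {N h : ℕ} (h1 : 2 * (h - 1) + 1 < N) (g : Fin N → ℝ) :
    ∑ x, mu C N h x * g x =
      al C h * g ⟨2 * (h - 1), by omega⟩ + (1 - al C h) * g ⟨2 * (h - 1) + 1, h1⟩ := by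
  rw [← sum_ind (N := N) (k := 2 * (h - 1)) (by omega) g, ← sum_ind h1 g, Finset.mul_sum,
    Finset.mul_sum, ← Finset.sum_add_distrib]
  apply Finset.sum_congr rfl
  intro x _
  unfold mu
  ring

section
variable {H : ℕ} {C ε : ℝ} (hH : 2 ≤ H) (hC : 10 ≤ C) (hε : 0 < ε) (hε1 : ε ≤ (C ^ H)⁻¹)

lemma al_bounds (hC : 10 ≤ C) (h : ℕ) : 0 ≤ al C h ∧ al C h ≤ 1 := by
  unfold al
  split_ifs
  · norm_num
  · exact ⟨by positivity, inv_le_one_of_one_le₀ (by linarith)⟩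

lemma Vs_le (π : Fin (2 * (H + 1)) → Fin 2) (n : ℕ) : ∀ x : Fin (2 * (H + 1)),
    x.val / 2 + 1 + n = H + 2 → (MM H C ε hH hC hε hε1).Vsteps π n x ≤ Ws H C ε x.val := by
  induction n with
  | zero => intro x hx; have := x.2; omega
  | succ n ih =>
    intro x hx
    have hb := bell_le (H := H) hC hε x.val (π x).val
    refine le_trans ?_ hb
    unfold LayeredMDP.Vsteps
    simp only [MM, PP]
    have hd := nx_div x.val (π x).val
    by_cases hk : nx x.val (π x).val < 2 * (H + 1)
    · rw [sum_ind hk]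
      have := ih ⟨_, hk⟩ (by simp only; omega)
      simp only [MM, PP] at this
      linarith
    · rw [sum_ind_big (by omega), Ws_big (by omega)]

lemma Vs_gen (c : Fin 2) (W : ℕ → ℝ)
    (hW : ∀ v, 2 * (H + 1) ≤ v → W v = 0)
    (hB : ∀ v, rew H C ε v c.val + W (nx v c.val) = W v) (n : ℕ) : ∀ x : Fin (2 * (H + 1)),
    x.val / 2 + 1 + n = H + 2 →
      (MM H C ε hH hC hε hε1).Vsteps (fun _ => c) n x = W x.val := by
  induction n with
  | zero => intro x hx; have := x.2; omega
  | succ n ih =>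
    intro x hx
    rw [← hB x.val]
    unfold LayeredMDP.Vsteps
    simp only [MM, PP]
    have hd := nx_div x.val c.val
    by_cases hk : nx x.val c.val < 2 * (H + 1)
    · rw [sum_ind hk]
      have := ih ⟨_, hk⟩ (by simp only; omega)
      simp only [MM, PP] at this
      rw [this]
    · rw [sum_ind_big (by omega), hW _ (by omega)]

lemma Vs_opt (n : ℕ) (x : Fin (2 * (H + 1))) (hx : x.val / 2 + 1 + n = H + 2) :
    (MM H C ε hH hC hε hε1).Vsteps (fun _ => 0) n x = Ws H C ε x.val :=
  Vs_gen hH hC hε hε1 0 _ (fun _ => Ws_big) bell_eq n x hx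

lemma Vs_hat (n : ℕ) (x : Fin (2 * (H + 1))) (hx : x.val / 2 + 1 + n = H + 2) :
    (MM H C ε hH hC hε hε1).Vsteps (fun _ => 1) n x = Wh H C ε x.val :=
  Vs_gen hH hC hε hε1 1 _ (fun _ => Wh_big hH) bellh_eq n x hx

lemma Q_hat (x : Fin (2 * (H + 1))) (a : Fin 2) :
    (MM H C ε hH hC hε hε1).Q (fun _ => 1) x a
      = rew H C ε x.val a.val + Wh H C ε (nx x.val a.val) := by
  have h1 : ∀ y, (MM H C ε hH hC hε hε1).P x a y
    = if y.val = nx x.val a.val then (1 : ℝ) else 0 := fun y => rfl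
  have h2 : (MM H C ε hH hC hε hε1).layer x = x.val / 2 + 1 := rfl
  have h3 : (MM H C ε hH hC hε hε1).R x a = rew H C ε x.val a.val := rfl
  unfold LayeredMDP.Q
  simp only [h1, h2, h3]
  have hd := nx_div x.val a.val
  by_cases hk : nx x.val a.val < 2 * (H + 1)
  · rw [sum_ind hk, Vs_hat hH hC hε hε1 _ _ (by simp only; omega)]
  · rw [sum_ind_big (by omega), Wh_big hH (by omega)]

lemma occ_path (π : Fin (2 * (H + 1)) → Fin 2) (p : ℕ → ℕ) (h0 : p 0 = 1) (K : ℕ)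
    (hp : ∀ k ≤ K, p k < 2 * (H + 1))
    (hs : ∀ k (hk : k < K), p (k + 1) = nx (p k) (π ⟨p k, hp k hk.le⟩).val) (k : ℕ) (hk : k ≤ K)
    (x : Fin (2 * (H + 1))) :
    (MM H C ε hH hC hε hε1).occAux π k x = if x.val = p k then 1 else 0 := by
  induction k generalizing x with
  | zero => rw [h0]; rfl
  | succ k ih =>
    unfold LayeredMDP.occAux
    simp only [ih (by omega)]
    rw [sum_ind (hp k (by omega)), hs k (by omega)]
    rfl

lemma mem_PiC {π : Fin (2 * (H + 1)) → Fin 2} :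
    π ∈ PiC H ↔ ∀ x y, x.val / 2 = y.val / 2 → π x = π y := by
  unfold PiC
  simp only [Finset.mem_image, Finset.mem_univ, true_and]
  constructor
  · rintro ⟨f, rfl⟩ x y h
    simp only [h]
  · intro h
    refine ⟨fun i => π ⟨2 * i.val, by have := i.2; omega⟩, ?_⟩
    funext x
    apply h
    simp only
    omega

lemma card_PiC : (PiC H).card ≤ 2 ^ (H + 1) := by
  refine Finset.card_image_le.trans ?_
  simp

lemma clos {π : Fin (2 * (H + 1)) → Fin 2}
    (h : (MM H C ε hH hC hε hε1).inClosure (PiC H) π) : π ∈ PiC H := by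
  rw [mem_PiC]
  intro x y hxy
  have hx := x.2
  obtain ⟨p, hp, hpe⟩ := h (x.val / 2 + 1) (by omega) (by omega)
  rw [hpe x rfl, hpe y (by rw [hxy]; rfl)]
  exact mem_PiC.1 hp x y hxy

lemma clos' {π : Fin (2 * (H + 1)) → Fin 2} (h : π ∈ PiC H) :
    (MM H C ε hH hC hε hε1).inClosure (PiC H) π :=
  fun _ _ _ => ⟨π, h, fun _ _ => rfl⟩

lemma adm {h : ℕ} (h1 : 1 ≤ h) (h2 : h ≤ H + 1) :
    (MM H C ε hH hC hε hε1).Admissible (PiC H) h (mu C _ h) := by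
  classical
  set A : Fin (2 * (H + 1)) → Fin 2 := fun x => if x.val / 2 + 2 = h then 0 else 1 with hA
  set B : Fin (2 * (H + 1)) → Fin 2 := fun x => 1 with hB
  have hAm : A ∈ PiC H := mem_PiC.2 fun x y hxy => by simp only [hA, hxy]
  have hBm : B ∈ PiC H := mem_PiC.2 fun x y hxy => rfl
  obtain ⟨a0, a1⟩ := al_bounds hC h
  have sm : ∀ g : (Fin (2 * (H + 1)) → Fin 2) → ℝ,
      ∑ π, (al C h * (if π = A then 1 else 0) + (1 - al C h) * (if π = B then 1 else 0)) * g π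
        = al C h * g A + (1 - al C h) * g B := by
    intro g
    simp [add_mul, Finset.sum_add_distrib, mul_assoc]
  refine ⟨fun π => al C h * (if π = A then 1 else 0) + (1 - al C h) * (if π = B then 1 else 0),
    ?_, ?_, ?_, ?_⟩
  · intro π
    have : 0 ≤ 1 - al C h := by linarith
    simp only
    positivity
  · have := sm (fun _ => 1)
    simp only [mul_one] at this
    rw [this]; ring
  · intro π hπ
    apply clos'
    by_cases e1 : π = A
    · rw [e1]; exact hAm
    by_cases e2 : π = B
    · rw [e2]; exact hBm
    simp [e1, e2] at hπ
  · intro x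
    rw [sm]
    unfold LayeredMDP.occ
    have oB := occ_path hH hC hε hε1 B (fun k => 2 * k + 1) rfl (h - 1)
      (by intro k hk; show 2 * k + 1 < _; omega)
      (by intro k hk
          simp only [hB, nx]
          split_ifs <;> first | omega | simp_all) (h - 1) le_rfl x
    rw [oB]
    by_cases hh : h = 1
    · have : al C h = 0 := by simp [al, hh]
      unfold mu
      rw [this]; ring
    have oA := occ_path hH hC hε hε1 A (fun k => if k = h - 1 then 2 * k else 2 * k + 1)
      (if_neg (by omega)) (h - 1)
      (by intro k hk; show (if k = h - 1 then 2 * k else 2 * k + 1) < _; split_ifs <;> omega)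
      (by intro k hk
          simp only [hA, nx]
          have e1 : k ≠ h - 1 := by omega
          simp only [if_neg e1]
          by_cases e2 : k + 1 = h - 1
          · have e3 : (2 * k + 1) / 2 + 2 = h := by omega
            simp only [if_pos e2, if_pos e3]
            simp
            omega
          · have e3 : ¬ ((2 * k + 1) / 2 + 2 = h) := by omega
            simp only [if_neg e2, if_neg e3]
            simp
            omega) (h - 1) le_rfl x
    rw [oA]
    simp only [if_true]
    rfl

lemma push (hC : 10 ≤ C) {h : ℕ} (h1 : 2 ≤ h) (x : Fin (2 * (H + 1))) (a : Fin 2)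
    (x' : Fin (2 * (H + 1))) (hx' : x'.val / 2 + 1 = h) :
    PP _ x a x' ≤ C * mu C _ h x' := by
  have hal : al C h = C⁻¹ := by simp [al]; omega
  have hp : PP _ x a x' ≤ 1 := by unfold PP; split_ifs <;> norm_num
  refine hp.trans ?_
  have hc : C * C⁻¹ = 1 := mul_inv_cancel₀ (by linarith)
  unfold mu
  rw [hal]
  by_cases e : x'.val = 2 * (h - 1)
  · rw [if_pos e, if_neg (by omega)]
    linarith
  · rw [if_neg e, if_pos (by omega)]
    linarith

lemma cb {h : ℕ} (h1 : 1 ≤ h) (h2 : h ≤ H + 1) :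
    (MM H C ε hH hC hε hε1).CB (PiC H) (mu C _ h) ε (fun _ => 1) (fun _ => 1) := by
  intro π hπ
  have hN : 2 * (h - 1) + 1 < 2 * (H + 1) := by omega
  rw [sum_mu hN, sum_mu hN]
  have hst := mem_PiC.1 hπ ⟨2 * (h - 1), by omega⟩ ⟨2 * (h - 1) + 1, hN⟩ (by simp only; omega)
  rw [hst]
  rcases (show π ⟨2 * (h - 1) + 1, hN⟩ = 0 ∨ π ⟨2 * (h - 1) + 1, hN⟩ = 1 by
    generalize π ⟨2 * (h - 1) + 1, hN⟩ = z; fin_cases z <;> simp) with e | e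
  swap
  · rw [e]; linarith
  rw [e]
  simp only [Q_hat]
  obtain ⟨k, rfl⟩ : ∃ k, h = k + 1 := ⟨h - 1, by omega⟩
  simp only [Nat.add_sub_cancel, Fin.val_zero, Fin.val_one, bellh_eq]
  have n1 : nx (2 * k) 0 = 2 * (k + 1) + 1 := by unfold nx; simp
  have n2 : nx (2 * k + 1) 0 = 2 * (k + 1) := by
    unfold nx; rw [if_neg (by omega), if_pos rfl]; omega
  rw [n1, n2]
  have w1 : Wh H C ε (2 * (k + 1) + 1) = D H C ε (k + 3) := by
    unfold Wh
    rw [if_neg (by omega), if_neg (by omega)]; congr 1; omega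
  have w2 : Wh H C ε (2 * (k + 1)) = D H C ε (k + 4) := by
    unfold Wh
    rw [if_pos (by omega)]; congr 1; omega
  have w3 : Wh H C ε (2 * k) = D H C ε (k + 3) := by
    unfold Wh
    rw [if_pos (by omega)]; congr 1; omega
  have r1 : rew H C ε (2 * k) 0 = D H C ε (k + 1) - D H C ε (k + 3) := by
    unfold rew
    rw [if_pos (by omega), if_pos rfl, show 2 * k / 2 = k by omega]
  have r2 : rew H C ε (2 * k + 1) 0 = 0 := by
    unfold rew
    rw [if_neg (by omega), if_pos rfl]
  rw [w1, w2, w3, r1, r2]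
  have d1 := D_five (H := H) hC hε (k + 1)
  have d2 := D_five (H := H) hC hε (k + 2)
  have d3 := D_five (H := H) hC hε (k + 3)
  have d4 := D_nonneg (H := H) hC hε (k + 4)
  simp only [add_assoc, Nat.reduceAdd] at d1 d2 d3
  rcases Nat.eq_zero_or_pos k with rfl | hk
  · simp only [al, Wh]
    norm_num at d3 d4 ⊢
    linarith
  have w4 : Wh H C ε (2 * k + 1) = D H C ε (k + 2) := by
    unfold Wh
    rw [if_neg (by omega), if_neg (by omega)]; congr 1; omega
  have hal : al C (k + 1) = C⁻¹ := by simp [al]; omega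
  rw [w4, hal]
  have hc : C⁻¹ * C = 1 := inv_mul_cancel₀ (by linarith)
  have hc0 : 0 < C⁻¹ := by positivity
  have hc1 : C⁻¹ ≤ 1 / 10 := by
    rw [inv_eq_one_div]; exact one_div_le_one_div_of_le (by norm_num) hC
  by_cases hkH : k + 1 ≤ H
  · have e1 : C⁻¹ * D H C ε (k + 1) = D H C ε (k + 2) / 2 := by
      rw [D_step hkH]
      linear_combination (D H C ε (k + 1 + 1) / 2) * hc
    nlinarith [mul_nonneg hc0.le d4, mul_nonneg hc0.le (show 0 ≤ D H C ε (k + 3) by linarith),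
      mul_le_mul_of_nonneg_right hc1 (show 0 ≤ D H C ε (k + 2) by linarith)]
  · have ek : k = H := by omega
    subst ek
    rw [D_last, D_big (h := k + 3) (by omega), D_big (h := k + 4) (by omega),
      D_big (h := k + 2) (by omega)]
    nlinarith

end

end PSDPLB

open LayeredMDP in
/-- Exponential error amplification of PSDP without policy completeness:
a lower bound against PSDP equipped with a worst-case `ε_stat`-approximate
policy-optimization oracle. -/
theorem psdp_exponential_lower_bound
    (H : ℕ) (hH : 2 ≤ H) (Cpush : ℝ) (hC : 5 * (H : ℝ) ≤ Cpush)
    (εstat : ℝ) (hε0 : 0 < εstat) (hε1 : εstat ≤ (Cpush ^ H)⁻¹) :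
    ∃ (n m : ℕ) (M : LayeredMDP (Fin n) (Fin m) (H + 1))
      (Pi : Finset (Fin n → Fin m)) (μ : ℕ → Fin n → ℝ)
      (πs : Fin n → Fin m) (pick : ℕ → Fin n → Fin m),
      -- at most 1 + H·(2H+3) states and at most H+2 actions
      n ≤ 1 + H * (2 * H + 3) ∧ m ≤ H + 2 ∧
      -- Π is a nonempty class of open-loop policies of size ≤ (H+2)·2^H
      Pi.Nonempty ∧
      (∀ π ∈ Pi, ∀ x y : Fin n, M.layer x = M.layer y → π x = π y) ∧
      Pi.card ≤ (H + 2) * 2 ^ H ∧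
      -- Π contains an optimal policy and is closed under layerwise recombination
      πs ∈ Pi ∧ M.IsOptimal πs ∧
      (∀ π : Fin n → Fin m, M.inClosure Pi π → π ∈ Pi) ∧
      -- μ is a family of reset distributions, admissible, with pushforward
      -- concentrability parameter C_push
      M.IsReset μ ∧
      (∀ h, 1 ≤ h → h ≤ H + 1 → M.Admissible Pi h (μ h)) ∧
      (∀ h, 2 ≤ h → h ≤ H + 1 → ∀ x a x', M.layer x = h - 1 → M.layer x' = h →
        M.P x a x' ≤ Cpush * μ h x') ∧
      -- the per-layer selections satisfy (CB_h) with rollout π̂_{h+1:H+1}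
      (∀ h, 1 ≤ h → h ≤ H + 1 →
        M.memLayer Pi h (pick h) ∧
        M.CB Pi (μ h) εstat (fun x => pick (M.layer x) x) (pick h)) ∧
      -- yet the composite policy is (C_push/2)^{H−1}·ε_stat suboptimal
      (Cpush / 2) ^ (H - 1) * εstat ≤
        M.value πs - M.value (fun x => pick (M.layer x) x) := by
  have hH' : (2 : ℝ) ≤ H := by exact_mod_cast hH
  have hC' : 10 ≤ Cpush := by linarith
  have key : ∀ c : Fin 2, (fun _ => c : Fin (2 * (H + 1)) → Fin 2) ∈ PSDPLB.PiC H :=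
    fun c => PSDPLB.mem_PiC.2 fun _ _ _ => rfl
  refine ⟨2 * (H + 1), 2, PSDPLB.MM H Cpush εstat hH hC' hε0 hε1, PSDPLB.PiC H,
    PSDPLB.mu Cpush _, fun _ => 0, fun _ _ => 1, by nlinarith, by omega, ⟨_, key 0⟩, ?_, ?_,
    key 0, ?_, fun π h => PSDPLB.clos hH hC' hε0 hε1 h, ⟨?_, ?_, ?_⟩,
    fun h h1 h2 => PSDPLB.adm hH hC' hε0 hε1 h1 h2, ?_, ?_, ?_⟩
  · intro π hπ x y hxy
    exact PSDPLB.mem_PiC.1 hπ x y (Nat.succ_injective hxy)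
  · refine PSDPLB.card_PiC.trans ?_
    rw [pow_succ, mul_comm]
    exact Nat.mul_le_mul_right _ (by omega)
  · intro x π
    have hx := x.2
    have hl : x.val / 2 + 1 + (H + 1 + 1 - (x.val / 2 + 1)) = H + 2 := by omega
    exact (PSDPLB.Vs_le hH hC' hε0 hε1 π _ x hl).trans
      (PSDPLB.Vs_opt hH hC' hε0 hε1 _ x hl).ge
  · intro h x
    obtain ⟨a0, a1⟩ := PSDPLB.al_bounds hC' h
    have : 0 ≤ 1 - PSDPLB.al Cpush h := by linarith
    unfold PSDPLB.mu
    positivity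
  · intro h h1 h2
    have := PSDPLB.sum_mu (C := Cpush) (N := 2 * (H + 1)) (h := h) (by omega) (fun _ => 1)
    simp only [mul_one] at this
    rw [this]; ring
  · intro h x h1 h2 hne
    change x.val / 2 + 1 = h
    by_contra hc
    apply hne
    unfold PSDPLB.mu
    rw [if_neg (by omega), if_neg (by omega)]
    ring
  · intro h h1 h2 x a x' _ hx'
    exact PSDPLB.push hC' h1 x a x' hx'
  · intro h h1 h2
    exact ⟨⟨_, key 1, fun _ _ => rfl⟩, PSDPLB.cb hH hC' hε0 hε1 h1 h2⟩
  · have hv : ∀ π, (PSDPLB.MM H Cpush εstat hH hC' hε0 hε1).value π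
        = (PSDPLB.MM H Cpush εstat hH hC' hε0 hε1).Vsteps π (H + 1) ⟨1, by omega⟩ := by
      intro π
      have h1 : 1 < 2 * (H + 1) := by omega
      have := PSDPLB.sum_ind h1 (fun x => (PSDPLB.MM H Cpush εstat hH hC' hε0 hε1).V π x)
      refine Eq.trans this ?_
      have e : H + 1 + 1 - (1 / 2 + 1) = H + 1 := by omega
      change (PSDPLB.MM H Cpush εstat hH hC' hε0 hε1).Vsteps π (H + 1 + 1 - (1 / 2 + 1)) _ = _
      rw [e]
    rw [hv, hv, PSDPLB.Vs_opt hH hC' hε0 hε1 _ _ (by simp only; omega),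
      PSDPLB.Vs_hat hH hC' hε0 hε1 _ _ (by simp only; omega)]
    have e1 : PSDPLB.Ws H Cpush εstat 1 = PSDPLB.D H Cpush εstat 2 := by simp [PSDPLB.Ws]
    have e2 : PSDPLB.Wh H Cpush εstat 1 = PSDPLB.D H Cpush εstat 3 := by simp [PSDPLB.Wh]
    have e3 : PSDPLB.D H Cpush εstat 2 = 2 * ((Cpush / 2) ^ (H - 1) * εstat) := by
      unfold PSDPLB.D
      rw [if_pos (by omega), show H + 1 - 2 = H - 1 by omega]; ring
    have e4 := PSDPLB.D_five (H := H) hC' hε0 2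
    have e5 := PSDPLB.D_nonneg (H := H) hC' hε0 3
    simp only [Nat.reduceAdd] at e4
    simp only [e1, e2]
    linarith
end

section
/- Existence of small policy emulators for pushforward-coverable MDPs: There exist universal constants K ≥ 1 and c ≥ 1 such that the following holds. For every finite-horizon layered MDP M whose pushforward coverability coefficient is at most C, where C ≥ 1, every finite policy class Π with |Π| ≥ 2, and every ε ∈ (0,1), there exists an ε-accurate policy emulator for Π and d_1 whose state space satisfies |X̂| ≤ K·(C·|A|·H·log|Π| / ε)^{c}. -/
open Finset

/-- Emulated values: backward recursion in a policy emulator with (nonnegative,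
possibly unnormalized) transition weights `Ŵ` and rewards `R̂`. -/
noncomputable def emulVsteps {X A : Type} [Fintype X]
    (What : X → A → X → ℝ) (Rhat : X → A → ℝ) (π : X → A) : ℕ → X → ℝ
  | 0, _ => 0
  | n + 1, x => Rhat x (π x) + ∑ x', What x (π x) x' * emulVsteps What Rhat π n x'

lemma pe_mgf {X : Type} [Fintype X] (μ f : X → ℝ) (hμ : ∀ x, 0 ≤ μ x) (hs : ∑ x, μ x = 1)
    (h0 : ∀ x, 0 ≤ f x) (h1 : ∀ x, f x ≤ 1) (l : ℝ) (hl : |l| ≤ 1) :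
    ∑ x, μ x * Real.exp (l * (f x - ∑ y, μ y * f y)) ≤ Real.exp (l ^ 2) := by
  set m := ∑ y, μ y * f y with hm
  have hm0 : 0 ≤ m := Finset.sum_nonneg fun x _ => mul_nonneg (hμ x) (h0 x)
  have hm1 : m ≤ 1 := by
    rw [← hs]
    exact Finset.sum_le_sum fun x _ => by nlinarith [hμ x, h1 x]
  have key : ∀ x, μ x * Real.exp (l * (f x - m)) ≤ μ x * (1 + l ^ 2) + l * (μ x * f x - m * μ x) := by
    intro x
    have hy : |f x - m| ≤ 1 := by
      rw [abs_le]; constructor <;> linarith [h0 x, h1 x]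
    have hz : |l * (f x - m)| ≤ 1 := by
      rw [abs_mul]; exact mul_le_one₀ hl (abs_nonneg _) hy
    have h2 := (abs_le.mp (Real.abs_exp_sub_one_sub_id_le hz)).2
    have h3 : (l * (f x - m)) ^ 2 ≤ l ^ 2 := by
      rw [mul_pow]
      have : (f x - m) ^ 2 ≤ 1 := by rw [← sq_abs]; exact pow_le_one₀ (abs_nonneg _) hy
      nlinarith [sq_nonneg l]
    have h4 : Real.exp (l * (f x - m)) ≤ 1 + l ^ 2 + l * (f x - m) := by linarith
    calc _ ≤ μ x * (1 + l ^ 2 + l * (f x - m)) := mul_le_mul_of_nonneg_left h4 (hμ x)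
      _ = _ := by ring
  calc _ ≤ ∑ x, (μ x * (1 + l ^ 2) + l * (μ x * f x - m * μ x)) := Finset.sum_le_sum fun x _ => key x
    _ = 1 + l ^ 2 := by
      rw [Finset.sum_add_distrib, ← Finset.sum_mul, ← Finset.mul_sum, Finset.sum_sub_distrib,
        ← Finset.mul_sum, hs, ← hm]; ring
    _ ≤ _ := by linarith [Real.add_one_le_exp (l ^ 2)]

lemma pe_prod {X : Type} [Fintype X] (n : ℕ) (g : X → ℝ) :
    ∑ σ : Fin n → X, ∏ i, g (σ i) = (∑ x, g x) ^ n := by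
  classical
  have := Finset.sum_pow' (Finset.univ : Finset X) g n
  rw [this]
  simp [Fintype.piFinset_univ]

open Classical in
lemma pe_tail {X : Type} [Fintype X] (μ f : X → ℝ) (hμ : ∀ x, 0 ≤ μ x) (hs : ∑ x, μ x = 1)
    (h0 : ∀ x, 0 ≤ f x) (h1 : ∀ x, f x ≤ 1) (n : ℕ) (s : ℝ) (s0 : 0 < s) (s1 : s ≤ 1) :
    ∑ σ : Fin n → X, (∏ i, μ (σ i)) *
      (if s * n < |∑ i, (f (σ i) - ∑ y, μ y * f y)| then (1:ℝ) else 0)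
      ≤ 2 * Real.exp (-(n * s ^ 2 / 4)) := by
  set m := ∑ y, μ y * f y with hm
  set e : ℝ := Real.exp (-(s / 2 * (s * n))) with he
  have key : ∀ σ : Fin n → X, (∏ i, μ (σ i)) *
      (if s * n < |∑ i, (f (σ i) - m)| then (1:ℝ) else 0) ≤
      e * ∏ i, (μ (σ i) * Real.exp (s / 2 * (f (σ i) - m))) +
      e * ∏ i, (μ (σ i) * Real.exp (-(s / 2) * (f (σ i) - m))) := by
    intro σ
    have hp : 0 ≤ ∏ i, μ (σ i) := Finset.prod_nonneg fun i _ => hμ _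
    rw [Finset.prod_mul_distrib, Finset.prod_mul_distrib, ← Real.exp_sum, ← Real.exp_sum,
      ← Finset.mul_sum, ← Finset.mul_sum]
    set T := ∑ i, (f (σ i) - m)
    have : (if s * n < |T| then (1:ℝ) else 0) ≤
        e * Real.exp (s / 2 * T) + e * Real.exp (-(s / 2) * T) := by
      rw [he, ← Real.exp_add, ← Real.exp_add]
      split_ifs with h
      · rcases lt_abs.mp h with h | h
        · have : 1 ≤ Real.exp (-(s / 2 * (s * n)) + s / 2 * T) := Real.one_le_exp (by nlinarith)
          linarith [Real.exp_pos (-(s / 2 * (s * n)) + -(s / 2) * T)]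
        · have : 1 ≤ Real.exp (-(s / 2 * (s * n)) + -(s / 2) * T) := Real.one_le_exp (by nlinarith)
          linarith [Real.exp_pos (-(s / 2 * (s * n)) + s / 2 * T)]
      · positivity
    calc _ ≤ _ := mul_le_mul_of_nonneg_left this hp
      _ = _ := by ring
  have b : ∀ l : ℝ, |l| ≤ 1 → (∑ x, μ x * Real.exp (l * (f x - m))) ^ n ≤ Real.exp (n * l ^ 2) := by
    intro l hl
    rw [Real.exp_nat_mul]
    exact pow_le_pow_left₀ (Finset.sum_nonneg fun x _ => mul_nonneg (hμ x) (Real.exp_pos _).le)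
      (pe_mgf μ f hμ hs h0 h1 l hl) n
  have b1 := b (s / 2) (by rw [abs_of_pos (by positivity)]; linarith)
  have b2 := b (-(s / 2)) (by rw [abs_neg, abs_of_pos (by positivity)]; linarith)
  have hE : e * Real.exp (n * (s / 2) ^ 2) = Real.exp (-(n * s ^ 2 / 4)) := by
    rw [he, ← Real.exp_add]; congr 1; ring
  have e0 : 0 ≤ e := (Real.exp_pos _).le
  calc _ ≤ _ := Finset.sum_le_sum fun σ _ => key σ
    _ = e * (∑ x, μ x * Real.exp (s / 2 * (f x - m))) ^ n +
        e * (∑ x, μ x * Real.exp (-(s / 2) * (f x - m))) ^ n := by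
      rw [Finset.sum_add_distrib, ← Finset.mul_sum, ← Finset.mul_sum,
        pe_prod n (fun x => μ x * Real.exp (s / 2 * (f x - m))),
        pe_prod n (fun x => μ x * Real.exp (-(s / 2) * (f x - m)))]
    _ ≤ e * Real.exp (n * (s / 2) ^ 2) + e * Real.exp (n * (-(s / 2)) ^ 2) := by gcongr
    _ = _ := by rw [neg_sq, hE]; ring

open Classical in
lemma pe_sample {X Z J : Type} [Fintype X] [Fintype Z] (μ : X → ℝ) (hμ : ∀ x, 0 ≤ μ x)
    (hs : ∑ x, μ x = 1) (ν : Z → ℝ) (hν : ∀ z, 0 ≤ ν z) (hνs : ∑ z, ν z = 1)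
    (Pi : Finset J) (F : Z → J → X → ℝ) (B : ℝ) (hB : 0 < B)
    (h0 : ∀ z, ν z ≠ 0 → ∀ j ∈ Pi, ∀ x, 0 ≤ F z j x)
    (h1 : ∀ z, ν z ≠ 0 → ∀ j ∈ Pi, ∀ x, F z j x ≤ B)
    (n : ℕ) (hn : 0 < n) (s δ : ℝ) (s0 : 0 < s) (s1 : s ≤ B)
    (hδ : 2 * Pi.card * Real.exp (-(n * (s / B) ^ 2 / 4)) ≤ δ) :
    ∃ σ : Fin n → X, ∑ z, ν z *
      (if ∀ j ∈ Pi, |(1 / n : ℝ) * ∑ i, F z j (σ i) - ∑ x, μ x * F z j x| ≤ s then (0:ℝ) else 1)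
        ≤ δ := by
  by_contra hcon
  push Not at hcon
  set I : Z → (Fin n → X) → ℝ := fun z σ =>
    (if ∀ j ∈ Pi, |(1 / n : ℝ) * ∑ i, F z j (σ i) - ∑ x, μ x * F z j x| ≤ s then (0:ℝ) else 1) with hI
  have hn' : (0:ℝ) < n := by exact_mod_cast hn
  have hw : ∀ σ : Fin n → X, 0 ≤ ∏ i, μ (σ i) := fun σ => Finset.prod_nonneg fun i _ => hμ _
  have hw1 : ∑ σ : Fin n → X, ∏ i, μ (σ i) = 1 := by rw [pe_prod, hs, one_pow]
  have hz : ∀ z, ν z * ∑ σ : Fin n → X, (∏ i, μ (σ i)) * I z σ ≤ ν z * δ := by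
    intro z
    by_cases hz : ν z = 0
    · simp [hz]
    apply mul_le_mul_of_nonneg_left _ (hν z)
    have hone : ∀ σ : Fin n → X, (∏ i, μ (σ i)) * I z σ ≤ ∑ j ∈ Pi, (∏ i, μ (σ i)) *
        (if s / B * n < |∑ i, (F z j (σ i) / B - ∑ y, μ y * (F z j y / B))| then (1:ℝ) else 0) := by
      intro σ
      rw [← Finset.mul_sum]
      apply mul_le_mul_of_nonneg_left _ (hw σ)
      have hnn : ∀ j ∈ Pi, (0:ℝ) ≤ (if s / B * n < |∑ i, (F z j (σ i) / B - ∑ y, μ y * (F z j y / B))| then (1:ℝ) else 0) := by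
        intro j _; split_ifs <;> norm_num
      simp only [hI]
      split_ifs with h
      · exact Finset.sum_nonneg hnn
      · push Not at h
        obtain ⟨j, hj, hlt⟩ := h
        refine le_trans ?_ (Finset.single_le_sum hnn hj)
        rw [if_pos]
        have : ∑ i, (F z j (σ i) / B - ∑ y, μ y * (F z j y / B)) =
            (n / B) * ((1 / n : ℝ) * ∑ i, F z j (σ i) - ∑ x, μ x * F z j x) := by
          simp only [Finset.sum_sub_distrib, ← mul_div_assoc, ← Finset.sum_div]
          simp
          field_simp
        rw [this, abs_mul, abs_of_pos (by positivity)]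
        calc s / B * n = n / B * s := by ring
          _ < _ := by gcongr
    calc _ ≤ _ := Finset.sum_le_sum fun σ _ => hone σ
      _ = _ := Finset.sum_comm
      _ ≤ ∑ j ∈ Pi, 2 * Real.exp (-(n * (s / B) ^ 2 / 4)) := by
        apply Finset.sum_le_sum
        intro j hj
        exact pe_tail μ (fun x => F z j x / B) hμ hs
          (fun x => div_nonneg (h0 z hz j hj x) hB.le)
          (fun x => (div_le_one hB).mpr (h1 z hz j hj x)) n (s / B) (by positivity)
          ((div_le_one hB).mpr s1)
      _ ≤ δ := by rw [Finset.sum_const, nsmul_eq_mul]; linarith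
  have hup : ∑ σ : Fin n → X, (∏ i, μ (σ i)) * ∑ z, ν z * I z σ ≤ δ := by
    calc _ = ∑ z, ν z * ∑ σ : Fin n → X, (∏ i, μ (σ i)) * I z σ := by
          simp only [Finset.mul_sum]
          rw [Finset.sum_comm]
          exact Finset.sum_congr rfl fun z _ => Finset.sum_congr rfl fun σ _ => by ring
      _ ≤ ∑ z, ν z * δ := Finset.sum_le_sum fun z _ => hz z
      _ = δ := by rw [← Finset.sum_mul, hνs, one_mul]
  have hne : ∃ σ : Fin n → X, 0 < ∏ i, μ (σ i) := by
    by_contra h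
    push Not at h
    have : ∑ σ : Fin n → X, ∏ i, μ (σ i) ≤ 0 := Finset.sum_nonpos fun σ _ => h σ
    linarith
  obtain ⟨σ0, hσ0⟩ := hne
  have hlow : ∑ σ : Fin n → X, (∏ i, μ (σ i)) * δ <
      ∑ σ : Fin n → X, (∏ i, μ (σ i)) * ∑ z, ν z * I z σ := by
    apply Finset.sum_lt_sum
    · exact fun σ _ => mul_le_mul_of_nonneg_left (hcon σ).le (hw σ)
    · exact ⟨σ0, Finset.mem_univ _, mul_lt_mul_of_pos_left (hcon σ0) hσ0⟩
  rw [← Finset.sum_mul, hw1, one_mul] at hlow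
  linarith

lemma pe_congr {X A : Type} [Fintype X] (W W' : X → A → X → ℝ) (R : X → A → ℝ) (π : X → A)
    (T : X → Prop) (hW : ∀ x, T x → ∀ a x', W' x a x' = W x a x')
    (hT : ∀ x, T x → ∀ a x', W x a x' ≠ 0 → T x') (k : ℕ) :
    ∀ x, T x → emulVsteps W' R π k x = emulVsteps W R π k x := by
  induction k with
  | zero => intro x _; rfl
  | succ k ih =>
    intro x hx
    simp only [emulVsteps]
    congr 1
    apply Finset.sum_congr rfl
    intro y _
    rw [hW x hx]
    by_cases h : W x (π x) y = 0
    · simp [h]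
    · rw [ih y (hT x hx _ _ h)]

lemma pe_emul_nonneg {X A : Type} [Fintype X] (W : X → A → X → ℝ) (R : X → A → ℝ) (π : X → A)
    (hW : ∀ x a x', 0 ≤ W x a x') (hR : ∀ x a, 0 ≤ R x a) (k : ℕ) :
    ∀ x, 0 ≤ emulVsteps W R π k x := by
  induction k with
  | zero => intro x; exact le_refl _
  | succ k ih =>
    intro x
    simp only [emulVsteps]
    exact add_nonneg (hR _ _) (Finset.sum_nonneg fun y _ => mul_nonneg (hW _ _ _) (ih y))

lemma pe_V_nonneg {X A : Type} [Fintype X] [Fintype A] {H : ℕ} (M : LayeredMDP X A H)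
    (π : X → A) (k : ℕ) : ∀ x, 0 ≤ M.Vsteps π k x := by
  induction k with
  | zero => intro x; exact le_refl _
  | succ k ih =>
    intro x
    simp only [LayeredMDP.Vsteps]
    exact add_nonneg (M.R_nonneg _ _)
      (Finset.sum_nonneg fun y _ => mul_nonneg (M.P_nonneg _ _ _) (ih y))

lemma pe_V_le {X A : Type} [Fintype X] [Fintype A] {H : ℕ} (M : LayeredMDP X A H)
    (π : X → A) (k : ℕ) : ∀ x, M.layer x + k ≤ H + 1 → M.Vsteps π k x ≤ k := by
  induction k with
  | zero => intro x _; simp [LayeredMDP.Vsteps]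
  | succ k ih =>
    intro x hx
    simp only [LayeredMDP.Vsteps]
    have h1 := M.R_le_one x (π x)
    rcases Nat.eq_zero_or_pos k with rfl | hk
    · simp [LayeredMDP.Vsteps, h1]
    have hl : M.layer x < H := by omega
    have : ∑ y, M.P x (π x) y * M.Vsteps π k y ≤ ∑ y, M.P x (π x) y * k := by
      apply Finset.sum_le_sum
      intro y _
      by_cases h : M.P x (π x) y = 0
      · simp [h]
      · have := M.P_supp x _ y hl h
        exact mul_le_mul_of_nonneg_left (ih y (by omega)) (M.P_nonneg _ _ _)
    rw [← Finset.sum_mul, M.P_sum_one x _ hl] at this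
    push_cast; linarith

open Classical in
/-- Backward-induction invariant: an emulator for the last `k + 1` layers. -/
def PEInv {X A : Type} [Fintype X] [Fintype A] {H : ℕ} (M : LayeredMDP X A H)
    (Pi : Finset (X → A)) (n : ℕ) (δ : ℝ) (ν : X → ℝ) (t : ℝ) (k : ℕ) : Prop :=
  ∃ (W : X → A → X → ℝ) (S : Finset X), (∀ x a x', 0 ≤ W x a x') ∧
    (∀ x a x', W x a x' ≠ 0 → x' ∈ S ∧ M.layer x' = M.layer x + 1) ∧ S.card ≤ k * n ∧
    ∑ x, ν x * (if ∀ π ∈ Pi, |emulVsteps W M.R π (k+1) x - M.Vsteps π (k+1) x| ≤ t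
      then (0:ℝ) else 1) ≤ δ

lemma pe_base {X A : Type} [Fintype X] [Fintype A] {H : ℕ} (M : LayeredMDP X A H)
    (Pi : Finset (X → A)) (n : ℕ) (δ : ℝ) (hδ : 0 ≤ δ) (ν : X → ℝ) (t : ℝ) (ht : 0 ≤ t) :
    PEInv M Pi n δ ν t 0 := by
  refine ⟨fun _ _ _ => 0, ∅, by simp, by simp, by simp, ?_⟩
  simp [emulVsteps, LayeredMDP.Vsteps, ht, hδ]

open Classical in
lemma pe_step {X A : Type} [Fintype X] [Fintype A] {H : ℕ} (M : LayeredMDP X A H)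
    (Pi : Finset (X → A)) (n : ℕ) (hn : 0 < n) (δ : ℝ) (C : ℝ) (hC : 1 ≤ C) (k : ℕ) (hk : k + 1 < H)
    (μ ν : X → ℝ) (hμ : ∀ x, 0 ≤ μ x) (hμs : ∑ x, μ x = 1)
    (hν : ∀ x, 0 ≤ ν x) (hνs : ∑ x, ν x = 1) (hνl : ∀ x, ν x ≠ 0 → M.layer x + (k + 1) = H)
    (hcov : ∀ x a y, M.layer x + (k + 1) = H → M.layer y + k = H → M.P x a y ≤ C * μ y)
    (t s : ℝ) (ht0 : 0 ≤ t) (ht1 : t ≤ 1) (s0 : 0 < s) (s1 : s ≤ 2 * C * H)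
    (hδ : 2 * Pi.card * Real.exp (-(n * (s / (2 * C * H)) ^ 2 / 4)) ≤ δ)
    (hI : PEInv M Pi n δ μ t k) : PEInv M Pi n δ ν (t + s + H * C * δ) (k + 1) := by
  obtain ⟨W, S, hW0, hWs, hS, hG⟩ := hI
  have hH : (1:ℝ) ≤ H := by exact_mod_cast (by omega : 1 ≤ H)
  set G : X → Prop := fun x => ∀ π ∈ Pi, |emulVsteps W M.R π (k+1) x - M.Vsteps π (k+1) x| ≤ t with hGdef
  set F : X → (X → A) → X → ℝ := fun x π y =>
    if G y ∧ M.layer y + k = H then M.P x (π x) y / μ y * emulVsteps W M.R π (k+1) y else 0 with hF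
  have hE0 : ∀ π y, 0 ≤ emulVsteps W M.R π (k+1) y := fun π y =>
    pe_emul_nonneg W M.R π hW0 M.R_nonneg (k+1) y
  have hVle : ∀ π y, M.layer y + k = H → M.Vsteps π (k+1) y ≤ H := by
    intro π y hy
    have h1 := pe_V_le M π (k+1) y (by omega)
    have h2 : ((k+1 : ℕ) : ℝ) ≤ H := by exact_mod_cast (by omega : k + 1 ≤ H)
    linarith
  have hF0 : ∀ z, ν z ≠ 0 → ∀ j ∈ Pi, ∀ x, 0 ≤ F z j x := by
    intro z _ j _ x
    simp only [hF]
    split_ifs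
    · exact mul_nonneg (div_nonneg (M.P_nonneg _ _ _) (hμ _)) (hE0 _ _)
    · exact le_refl _
  have hF1 : ∀ z, ν z ≠ 0 → ∀ j ∈ Pi, ∀ x, F z j x ≤ 2 * C * H := by
    intro z hz j hj x
    simp only [hF]
    split_ifs with h
    · have h1 : M.P z (j z) x / μ x ≤ C := by
        rcases (hμ x).eq_or_lt with h0 | h0
        · rw [← h0, div_zero]; linarith
        · rw [div_le_iff₀ h0]; exact hcov z _ x (hνl z hz) h.2
      have h2 : emulVsteps W M.R j (k+1) x ≤ 2 * H := by
        have := (abs_le.mp (h.1 j hj)).2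
        linarith [hVle j x h.2]
      calc _ ≤ C * (2 * H) := mul_le_mul h1 h2 (hE0 _ _) (by linarith)
        _ = _ := by ring
    · positivity
  obtain ⟨σ, hσ⟩ := pe_sample μ hμ hμs ν hν hνs Pi F (2 * C * H) (by positivity) hF0 hF1 n hn s δ s0 s1 hδ
  set W' : X → A → X → ℝ := fun x a y =>
    if M.layer x + (k + 1) = H then
      (if G y ∧ M.layer y + k = H then
        (1 / n : ℝ) * (∑ i, if σ i = y then (1:ℝ) else 0) * (M.P x a y / μ y) else 0)
    else W x a y with hW'
  have hn' : (0:ℝ) < n := by exact_mod_cast hn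
  have hagree : ∀ π y, M.layer y + k = H → emulVsteps W' M.R π (k+1) y = emulVsteps W M.R π (k+1) y := by
    intro π y hy
    apply pe_congr W W' M.R π (fun x => H ≤ M.layer x + k)
    · intro x hx a x'
      simp only [hW']
      rw [if_neg (by omega)]
    · intro x hx a x' h
      have := (hWs x a x' h).2
      omega
    · omega
  refine ⟨W', S ∪ Finset.univ.image σ, ?_, ?_, ?_, ?_⟩
  · intro x a y
    simp only [hW']
    split_ifs
    · exact mul_nonneg (mul_nonneg (by positivity)
        (Finset.sum_nonneg fun i _ => by split_ifs <;> norm_num))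
        (div_nonneg (M.P_nonneg _ _ _) (hμ _))
    · exact le_refl _
    · exact hW0 _ _ _
  · intro x a y h
    simp only [hW'] at h
    split_ifs at h with h1 h2
    · refine ⟨?_, by omega⟩
      apply Finset.mem_union_right
      by_contra hy
      apply h
      have : ∀ i, σ i ≠ y := fun i hi => hy (Finset.mem_image.mpr ⟨i, Finset.mem_univ _, hi⟩)
      simp [this]
    · exact absurd rfl h
    · exact ⟨Finset.mem_union_left _ (hWs x a y h).1, (hWs x a y h).2⟩
  · calc _ ≤ S.card + (Finset.univ.image σ).card := Finset.card_union_le _ _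
      _ ≤ k * n + n := by
        apply Nat.add_le_add hS
        exact Finset.card_image_le.trans (by simp)
      _ = _ := by ring
  · refine le_trans (Finset.sum_le_sum fun x _ => ?_) hσ
    by_cases hx : ν x = 0
    · simp [hx]
    apply mul_le_mul_of_nonneg_left _ (hν x)
    have hxl := hνl x hx
    by_cases hg : ∀ j ∈ Pi, |(1 / n : ℝ) * ∑ i, F x j (σ i) - ∑ y, μ y * F x j y| ≤ s
    swap
    · rw [if_neg hg]; split_ifs <;> norm_num
    rw [if_pos hg, if_pos]
    intro π hπ
    have h1 : emulVsteps W' M.R π (k+1+1) x = M.R x (π x) + (1 / n : ℝ) * ∑ i, F x π (σ i) := by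
      rw [emulVsteps]
      congr 1
      have : ∀ y, W' x (π x) y * emulVsteps W' M.R π (k+1) y =
          ∑ i, (1 / n : ℝ) * (if σ i = y then F x π y else 0) := by
        intro y
        simp only [hW', if_pos hxl]
        by_cases hy : G y ∧ M.layer y + k = H
        · rw [if_pos hy, ← Finset.mul_sum]
          have e2 : ∑ i, (if σ i = y then F x π y else 0) =
              (∑ i, if σ i = y then (1:ℝ) else 0) * F x π y := by
            rw [Finset.sum_mul]; exact Finset.sum_congr rfl fun i _ => by split_ifs <;> simp
          rw [e2]
          have e3 : F x π y = M.P x (π x) y / μ y * emulVsteps W M.R π (k+1) y := by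
            simp only [hF]; rw [if_pos hy]
          rw [e3]
          have := hagree π y hy.2
          simp only [hW'] at this
          rw [this]; ring
        · rw [if_neg hy]
          have e3 : F x π y = 0 := by simp only [hF]; rw [if_neg hy]
          simp [e3]
      rw [Finset.sum_congr rfl fun y _ => this y, Finset.sum_comm, Finset.mul_sum]
      apply Finset.sum_congr rfl
      intro i _
      rw [← Finset.mul_sum, Finset.sum_ite_eq]
      simp
    have h2 : M.Vsteps π (k+1+1) x = M.R x (π x) + ∑ y, M.P x (π x) y * M.Vsteps π (k+1) y := by
      rw [LayeredMDP.Vsteps]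
    have hxH : M.layer x < H := by omega
    have h3 : |∑ y, μ y * F x π y - ∑ y, M.P x (π x) y * M.Vsteps π (k+1) y| ≤ t + H * C * δ := by
      rw [← Finset.sum_sub_distrib]
      refine (Finset.abs_sum_le_sum_abs _ _).trans ?_
      have key : ∀ y, |μ y * F x π y - M.P x (π x) y * M.Vsteps π (k+1) y| ≤
          M.P x (π x) y * t + H * C * (μ y * (if G y then (0:ℝ) else 1)) := by
        intro y
        have hr : 0 ≤ H * C * (μ y * (if G y then (0:ℝ) else 1)) :=
          mul_nonneg (by positivity) (mul_nonneg (hμ y) (by split_ifs <;> norm_num))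
        by_cases hP : M.P x (π x) y = 0
        · have e3 : F x π y = 0 := by simp [hF, hP]
          rw [e3, hP]; simpa using hr
        · have hyl : M.layer y + k = H := by have := M.P_supp x _ y hxH hP; omega
          have hPp : 0 < M.P x (π x) y := lt_of_le_of_ne (M.P_nonneg _ _ _) (Ne.symm hP)
          have hc := hcov x (π x) y hxl hyl
          have hμp : 0 < μ y := by
            by_contra hh
            nlinarith [hμ y]
          by_cases hy : G y
          · have e3 : F x π y = M.P x (π x) y / μ y * emulVsteps W M.R π (k+1) y := by
              simp only [hF]; rw [if_pos ⟨hy, hyl⟩]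
            have e4 : μ y * F x π y - M.P x (π x) y * M.Vsteps π (k+1) y =
                M.P x (π x) y * (emulVsteps W M.R π (k+1) y - M.Vsteps π (k+1) y) := by
              rw [e3]; field_simp
            rw [e4, abs_mul, abs_of_pos hPp]
            have := mul_le_mul_of_nonneg_left (hy π hπ) hPp.le
            linarith
          · have e3 : F x π y = 0 := by simp only [hF]; rw [if_neg (fun h => hy h.1)]
            rw [e3, if_neg hy, mul_zero, zero_sub, abs_neg,
              abs_of_nonneg (mul_nonneg hPp.le (pe_V_nonneg M π _ y))]
            have := mul_le_mul hc (hVle π y hyl) (pe_V_nonneg M π _ y) (by positivity)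
            have := mul_nonneg hPp.le ht0
            linarith
      refine (Finset.sum_le_sum fun y _ => key y).trans ?_
      rw [Finset.sum_add_distrib, ← Finset.sum_mul, M.P_sum_one x _ hxH, ← Finset.mul_sum, one_mul]
      have := mul_le_mul_of_nonneg_left hG (by positivity : 0 ≤ (H:ℝ) * C)
      linarith
    have h4 := hg π hπ
    rw [h1, h2]
    rw [abs_le] at h3 h4 ⊢
    constructor <;> linarith [h3.1, h3.2, h4.1, h4.2]

open Classical in
lemma pe_final {X A : Type} [Fintype X] [Fintype A] {H : ℕ} (M : LayeredMDP X A H)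
    (Pi : Finset (X → A)) (n : ℕ) (hn : 0 < n) (δ : ℝ) (hδ1 : δ < 1) (C : ℝ) (hC : 1 ≤ C)
    (hH1 : 1 ≤ H) (t s : ℝ) (ht0 : 0 ≤ t) (ht1 : t ≤ 1) (s0 : 0 < s) (s1 : s ≤ 2 * C * H)
    (hδ : 2 * Pi.card * Real.exp (-(n * (s / (2 * C * H)) ^ 2 / 4)) ≤ δ)
    (hI : PEInv M Pi n δ M.d1 t (H - 1)) :
    ∃ (Xhat : Finset X) (What : X → A → X → ℝ) (νhat : X → ℝ),
      (∀ x a x', 0 ≤ What x a x') ∧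
      (∀ x a x', What x a x' ≠ 0 →
        x ∈ Xhat ∧ x' ∈ Xhat ∧ M.layer x' = M.layer x + 1) ∧
      (∀ x, 0 ≤ νhat x) ∧ (∑ x, νhat x = 1) ∧
      (∀ x, νhat x ≠ 0 → x ∈ Xhat ∧ M.layer x = 1) ∧
      (∀ π ∈ Pi,
        |(∑ x, M.d1 x * M.V π x) -
          ∑ x, νhat x * emulVsteps What M.R π (H + 1 - M.layer x) x| ≤ t + s + 2 * H * δ) ∧
      Xhat.card ≤ H * n := by
  obtain ⟨W, S, hW0, hWs, hS, hG⟩ := hI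
  have hk : H - 1 + 1 = H := by omega
  rw [hk] at hG
  have hH : (1:ℝ) ≤ H := by exact_mod_cast hH1
  set G : X → Prop := fun x => ∀ π ∈ Pi, |emulVsteps W M.R π H x - M.Vsteps π H x| ≤ t with hGdef
  have hn' : (0:ℝ) < n := by exact_mod_cast hn
  have hg : ∃ g, G g ∧ M.layer g = 1 := by
    by_contra hcon
    push Not at hcon
    have : ∑ x, M.d1 x * (if G x then (0:ℝ) else 1) = 1 := by
      refine Eq.trans ?_ M.d1_sum_one
      apply Finset.sum_congr rfl
      intro x _
      by_cases hx : M.d1 x = 0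
      · simp [hx]
      · rw [if_neg (fun h => hcon x h (M.d1_supp x hx)), mul_one]
    linarith
  obtain ⟨g, hgG, hgl⟩ := hg
  set φ : X → X := fun x => if G x ∧ M.layer x = 1 then x else g with hφ
  have hφG : ∀ x, G (φ x) ∧ M.layer (φ x) = 1 := by
    intro x; simp only [hφ]; split_ifs with h
    · exact h
    · exact ⟨hgG, hgl⟩
  have hE0 : ∀ π y, 0 ≤ emulVsteps W M.R π H y := fun π y =>
    pe_emul_nonneg W M.R π hW0 M.R_nonneg H y
  have hVle : ∀ π y, M.layer y = 1 → M.Vsteps π H y ≤ H := fun π y hy =>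
    pe_V_le M π H y (by omega)
  have hEle : ∀ π ∈ Pi, ∀ x, emulVsteps W M.R π H (φ x) ≤ 2 * H := by
    intro π hπ x
    have := (abs_le.mp ((hφG x).1 π hπ)).2
    linarith [hVle π _ (hφG x).2]
  obtain ⟨σ, hσ⟩ := pe_sample (Z := Unit) M.d1 M.d1_nonneg M.d1_sum_one (fun _ => 1) (by simp) (by simp)
    Pi (fun _ π x => emulVsteps W M.R π H (φ x)) (2 * C * H) (by positivity)
    (fun _ _ j _ x => hE0 j _) (fun _ _ j hj x => (hEle j hj x).trans (by nlinarith))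
    n hn s δ s0 s1 hδ
  have hσ' : ∀ j ∈ Pi, |(1 / n : ℝ) * ∑ i, emulVsteps W M.R j H (φ (σ i)) -
      ∑ x, M.d1 x * emulVsteps W M.R j H (φ x)| ≤ s := by
    by_contra hcon
    simp only [Finset.univ_unique, Finset.sum_singleton] at hσ
    rw [if_neg hcon] at hσ
    linarith
  set Xh : Finset X := S ∪ Finset.univ.image (fun i => φ (σ i)) with hXh
  set W' : X → A → X → ℝ := fun x a y => if x ∈ Xh then W x a y else 0 with hW'
  set ν : X → ℝ := fun x => (1 / n : ℝ) * ∑ i, if φ (σ i) = x then (1:ℝ) else 0 with hν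
  have hνsum : ∀ f : X → ℝ, ∑ x, ν x * f x = (1 / n : ℝ) * ∑ i, f (φ (σ i)) := by
    intro f
    simp only [hν, mul_assoc, ← Finset.mul_sum]
    congr 1
    simp only [Finset.sum_mul]
    rw [Finset.sum_comm]
    apply Finset.sum_congr rfl
    intro i _
    simp [ite_mul]
  have hνs : ∀ x, ν x ≠ 0 → x ∈ Xh ∧ M.layer x = 1 := by
    intro x hx
    by_cases h : ∃ i, φ (σ i) = x
    · obtain ⟨i, rfl⟩ := h
      exact ⟨Finset.mem_union_right _ (Finset.mem_image.mpr ⟨i, Finset.mem_univ _, rfl⟩), (hφG _).2⟩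
    · push Not at h
      exact absurd (by simp [hν, h]) hx
  refine ⟨Xh, W', ν, ?_, ?_, ?_, ?_, hνs, ?_, ?_⟩
  · intro x a y
    simp only [hW']
    split_ifs
    · exact hW0 _ _ _
    · exact le_refl _
  · intro x a y h
    simp only [hW'] at h
    split_ifs at h with h1
    · exact ⟨h1, Finset.mem_union_left _ (hWs x a y h).1, (hWs x a y h).2⟩
    · exact absurd rfl h
  · intro x
    simp only [hν]
    exact mul_nonneg (by positivity) (Finset.sum_nonneg fun i _ => by split_ifs <;> norm_num)
  · have := hνsum (fun _ => 1)
    simp only [mul_one] at this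
    rw [this]
    simp
    field_simp
  · intro π hπ
    have h1 : ∑ x, ν x * emulVsteps W' M.R π (H + 1 - M.layer x) x =
        (1 / n : ℝ) * ∑ i, emulVsteps W M.R π H (φ (σ i)) := by
      rw [← hνsum]
      apply Finset.sum_congr rfl
      intro x _
      by_cases hx : ν x = 0
      · simp [hx]
      obtain ⟨hx1, hx2⟩ := hνs x hx
      rw [hx2, Nat.add_sub_cancel]
      congr 1
      apply pe_congr W W' M.R π (fun x => x ∈ Xh)
      · intro x hx a x'; simp only [hW']; rw [if_pos hx]
      · intro x hx a x' h; exact Finset.mem_union_left _ (hWs x a x' h).1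
      · exact hx1
    have h3 : |∑ x, M.d1 x * M.V π x - ∑ x, M.d1 x * emulVsteps W M.R π H (φ x)| ≤ t + 2 * H * δ := by
      rw [← Finset.sum_sub_distrib]
      refine (Finset.abs_sum_le_sum_abs _ _).trans ?_
      have key : ∀ y, |M.d1 y * M.V π y - M.d1 y * emulVsteps W M.R π H (φ y)| ≤
          M.d1 y * t + 2 * H * (M.d1 y * (if G y then (0:ℝ) else 1)) := by
        intro y
        by_cases hy : M.d1 y = 0
        · simp [hy]
        have hyl := M.d1_supp y hy
        have hV : M.V π y = M.Vsteps π H y := by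
          rw [LayeredMDP.V, hyl, Nat.add_sub_cancel]
        rw [← mul_sub, abs_mul, abs_of_nonneg (M.d1_nonneg y), hV]
        by_cases hGy : G y
        · have : φ y = y := by simp only [hφ]; rw [if_pos ⟨hGy, hyl⟩]
          rw [this, if_pos hGy, abs_sub_comm]
          have := mul_le_mul_of_nonneg_left (hGy π hπ) (M.d1_nonneg y)
          linarith
        · rw [if_neg hGy]
          have : |M.Vsteps π H y - emulVsteps W M.R π H (φ y)| ≤ 2 * H := by
            rw [abs_le]
            constructor <;> linarith [hEle π hπ y, hE0 π (φ y), hVle π y hyl, pe_V_nonneg M π H y]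
          have := mul_le_mul_of_nonneg_left this (M.d1_nonneg y)
          have := mul_nonneg (M.d1_nonneg y) ht0
          linarith
      refine (Finset.sum_le_sum fun y _ => key y).trans ?_
      rw [Finset.sum_add_distrib, ← Finset.sum_mul, M.d1_sum_one, ← Finset.mul_sum, one_mul]
      have := mul_le_mul_of_nonneg_left hG (by positivity : 0 ≤ 2 * (H:ℝ))
      linarith
    have h4 := hσ' π hπ
    rw [h1]
    rw [abs_le] at h3 h4 ⊢
    constructor <;> linarith [h3.1, h3.2, h4.1, h4.2]
  · calc _ ≤ S.card + (Finset.univ.image (fun i => φ (σ i))).card := Finset.card_union_le _ _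
      _ ≤ (H - 1) * n + n := by
        apply Nat.add_le_add hS
        exact Finset.card_image_le.trans (by simp)
      _ = (H - 1 + 1) * n := by ring
      _ = _ := by rw [hk]

lemma pe_induct {X A : Type} [Fintype X] [Fintype A] {H : ℕ} (M : LayeredMDP X A H)
    (Pi : Finset (X → A)) (n : ℕ) (hn : 0 < n) (δ : ℝ) (hδ0 : 0 ≤ δ) (C : ℝ) (hC : 1 ≤ C)
    (hcov : ∀ h, 2 ≤ h → h ≤ H → ∃ μh : X → ℝ,
          (∀ x, 0 ≤ μh x) ∧ (∑ x, μh x = 1) ∧ (∀ x, μh x ≠ 0 → M.layer x = h) ∧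
            ∀ x a x', M.layer x = h - 1 → M.layer x' = h → M.P x a x' ≤ C * μh x')
    (hH1 : 1 ≤ H) (s : ℝ) (s0 : 0 < s) (s1 : s ≤ 2 * C * H)
    (hδ : 2 * Pi.card * Real.exp (-(n * (s / (2 * C * H)) ^ 2 / 4)) ≤ δ)
    (hT : H * (s + H * C * δ) ≤ 1) :
    PEInv M Pi n δ M.d1 ((H - 1 : ℕ) * (s + H * C * δ)) (H - 1) := by
  have hd : 0 ≤ s + H * C * δ := by positivity
  have hall : ∀ h, 1 ≤ h → h ≤ H → ∃ μh : X → ℝ,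
      (∀ x, 0 ≤ μh x) ∧ (∑ x, μh x = 1) ∧ (∀ x, μh x ≠ 0 → M.layer x = h) ∧
      (2 ≤ h → ∀ x a x', M.layer x = h - 1 → M.layer x' = h → M.P x a x' ≤ C * μh x') ∧
      (h = 1 → μh = M.d1) := by
    intro h h1 hh
    rcases Nat.lt_or_ge h 2 with h2 | h2
    · obtain rfl : h = 1 := by omega
      exact ⟨M.d1, M.d1_nonneg, M.d1_sum_one, M.d1_supp, fun h => by omega, fun _ => rfl⟩
    · obtain ⟨μ, a, b, c, d⟩ := hcov h h2 hh
      exact ⟨μ, a, b, c, fun _ => d, fun h => by omega⟩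
  choose! μ hμ0 hμs hμl hμc hμ1 using hall
  have main : ∀ k, k < H → PEInv M Pi n δ (μ (H - k)) (k * (s + H * C * δ)) k := by
    intro k
    induction k with
    | zero => intro _; exact pe_base M Pi n δ hδ0 _ _ (by simp)
    | succ k ih =>
      intro hk
      have hkH : (k:ℝ) ≤ H := by exact_mod_cast (by omega : k ≤ H)
      have := pe_step M Pi n hn δ C hC k hk (μ (H - k)) (μ (H - (k+1)))
        (hμ0 _ (by omega) (by omega)) (hμs _ (by omega) (by omega))
        (hμ0 _ (by omega) (by omega)) (hμs _ (by omega) (by omega))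
        (fun x hx => by have := hμl (H - (k+1)) (by omega) (by omega) x hx; omega)
        (fun x a y hx hy => hμc (H - k) (by omega) (by omega) (by omega) x a y (by omega) (by omega))
        (k * (s + H * C * δ)) s (by positivity)
        ((mul_le_mul_of_nonneg_right hkH hd).trans hT) s0 s1 hδ (ih (by omega))
      convert this using 1
      push_cast; ring
  have := main (H - 1) (by omega)
  rwa [hμ1 (H - (H - 1)) (by omega) (by omega) (by omega)] at this

set_option maxHeartbeats 1000000 in
open LayeredMDP in
/-- Existence of small policy emulators for pushforward-coverable
MDPs: there are universal constants `K, c ≥ 1` such that every finite-horizon layered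
MDP with pushforward coverability coefficient at most `C ≥ 1` admits, for every finite
policy class `Π` with `|Π| ≥ 2` and every `ε ∈ (0,1)`, an `ε`-accurate policy emulator
for `Π` and `d_1` on a state space of size at most `K·(C·|A|·H·log|Π|/ε)^c`. -/
theorem policy_emulator_existence :
    ∃ K c : ℝ, 1 ≤ K ∧ 1 ≤ c ∧
      ∀ (X A : Type) [Fintype X] [Fintype A] (H : ℕ)
        (M : LayeredMDP X A H) (C : ℝ), 1 ≤ C →
        -- pushforward coverability coefficient at most C
        (∀ h, 2 ≤ h → h ≤ H → ∃ μh : X → ℝ,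
          (∀ x, 0 ≤ μh x) ∧ (∑ x, μh x = 1) ∧ (∀ x, μh x ≠ 0 → M.layer x = h) ∧
            ∀ x a x', M.layer x = h - 1 → M.layer x' = h → M.P x a x' ≤ C * μh x') →
        ∀ (Pi : Finset (X → A)), 2 ≤ Pi.card →
        ∀ ε : ℝ, 0 < ε → ε < 1 →
        ∃ (Xhat : Finset X) (What : X → A → X → ℝ) (Rhat : X → A → ℝ) (νhat : X → ℝ),
          -- Ŵ : nonnegative weights on X̂_{h+1}
          (∀ x a x', 0 ≤ What x a x') ∧
          (∀ x a x', What x a x' ≠ 0 →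
            x ∈ Xhat ∧ x' ∈ Xhat ∧ M.layer x' = M.layer x + 1) ∧
          -- R̂ : X̂ × A → [0,1]
          (∀ x ∈ Xhat, ∀ a : A, 0 ≤ Rhat x a ∧ Rhat x a ≤ 1) ∧
          -- ν̂ : probability distribution on X̂_1
          (∀ x, 0 ≤ νhat x) ∧ (∑ x, νhat x = 1) ∧
          (∀ x, νhat x ≠ 0 → x ∈ Xhat ∧ M.layer x = 1) ∧
          -- ε-accuracy for Π and d_1
          (∀ π ∈ Pi,
            |(∑ x, M.d1 x * M.V π x) -
              ∑ x, νhat x * emulVsteps What Rhat π (H + 1 - M.layer x) x| ≤ ε) ∧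
          -- bounded state space
          (Xhat.card : ℝ) ≤
            K * (C * (Fintype.card A) * H * Real.log (Pi.card) / ε) ^ c := by
  refine ⟨2305, 7, by norm_num, by norm_num, ?_⟩
  intro X A _ _ H M C hC hcov Pi hPi ε hε0 hε1
  have hXne : ∃ x : X, True := by
    by_contra h
    push Not at h
    have := M.d1_sum_one
    rw [Finset.sum_eq_zero (fun x _ => absurd (h x) (by simp))] at this
    norm_num at this
  obtain ⟨x0, -⟩ := hXne
  have hH1 : 1 ≤ H := (M.layer_lb x0).trans (M.layer_ub x0)
  have hA : 2 ≤ Fintype.card A := by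
    obtain ⟨f, hf, g, hg, hne⟩ := Finset.one_lt_card.mp (by omega : 1 < Pi.card)
    obtain ⟨x, hx⟩ := Function.ne_iff.mp hne
    exact Fintype.one_lt_card_iff.mpr ⟨_, _, hx⟩
  have hH : (1:ℝ) ≤ H := by exact_mod_cast hH1
  have hA' : (2:ℝ) ≤ Fintype.card A := by exact_mod_cast hA
  have hP' : (2:ℝ) ≤ Pi.card := by exact_mod_cast hPi
  set L := Real.log Pi.card with hL
  have hL2 : 1 / 2 ≤ L := by
    have h1 : Real.log 2 ≤ L := Real.log_le_log (by norm_num) hP'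
    linarith [Real.log_two_gt_d9]
  set a : ℝ := ((Fintype.card A : ℕ) : ℝ) with ha
  set Z := C * a * H * L / ε with hZ
  set s : ℝ := ε / (4 * H) with hs
  set δ : ℝ := ε / (4 * H ^ 2 * C) with hδ
  have hC0 : 0 < C := by linarith
  have hH0 : (0:ℝ) < H := by linarith
  have hs0 : 0 < s := by positivity
  have hδ0 : 0 < δ := by positivity
  have hs1 : s ≤ 1 := by rw [hs, div_le_one (by positivity)]; linarith
  have hδ1 : δ < 1 := by
    rw [hδ, div_lt_one (by positivity)]
    have : 1 ≤ (H:ℝ) ^ 2 * C := one_le_mul_of_one_le_of_one_le (one_le_pow₀ hH) hC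
    linarith
  have hHCδ : H * C * δ = s := by rw [hδ, hs]; field_simp
  have hs1' : s ≤ 2 * C * H := by nlinarith
  have hHs : H * s = ε / 4 := by rw [hs]; field_simp
  set q : ℝ := s / (2 * C * H) with hq
  have hq0 : 0 < q := by positivity
  set r : ℝ := 4 / q ^ 2 * (L + 8 * H ^ 2 * C / ε) with hr
  have hr0 : 0 < r := by positivity
  set n := ⌈r⌉₊ with hn
  have hn0 : 0 < n := Nat.ceil_pos.mpr hr0
  have hnr : r ≤ n := Nat.le_ceil r
  have hexp : 2 * (Pi.card : ℝ) * Real.exp (-(n * q ^ 2 / 4)) ≤ δ := by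
    have h1 : L + 8 * H ^ 2 * C / ε ≤ n * q ^ 2 / 4 := by
      have : r * q ^ 2 / 4 = L + 8 * H ^ 2 * C / ε := by rw [hr]; field_simp
      rw [← this]; gcongr
    have h2 : (Pi.card : ℝ) * (8 * H ^ 2 * C / ε) ≤ Real.exp (n * q ^ 2 / 4) := by
      refine le_trans ?_ (Real.exp_le_exp.mpr h1)
      rw [Real.exp_add, hL, Real.exp_log (by linarith)]
      gcongr
      linarith [Real.add_one_le_exp (8 * H ^ 2 * C / ε)]
    rw [Real.exp_neg, ← div_eq_mul_inv, div_le_iff₀ (Real.exp_pos _)]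
    calc 2 * (Pi.card : ℝ) = δ * (Pi.card * (8 * H ^ 2 * C / ε)) := by rw [hδ]; field_simp; ring
      _ ≤ _ := by gcongr
  have hT : H * (s + H * C * δ) ≤ 1 := by rw [hHCδ]; linarith
  have hind := pe_induct M Pi n hn0 δ hδ0.le C hC hcov hH1 s hs0 hs1' hexp hT
  have hd0 : 0 ≤ s + H * C * δ := by positivity
  have hcast : ((H - 1 : ℕ) : ℝ) = H - 1 := by push_cast [Nat.cast_sub hH1]; ring
  have ht1 : ((H - 1 : ℕ) : ℝ) * (s + H * C * δ) ≤ 1 := by rw [hcast]; linarith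
  obtain ⟨Xh, W, ν, p1, p2, p3, p4, p5, p6, p7⟩ := pe_final M Pi n hn0 δ hδ1 C hC hH1
    _ s (by positivity) ht1 hs0 hs1' hexp hind
  refine ⟨Xh, W, M.R, ν, p1, p2, fun x _ b => ⟨M.R_nonneg x b, M.R_le_one x b⟩, p3, p4, p5, ?_, ?_⟩
  · intro π hπ
    refine (p6 π hπ).trans ?_
    rw [hcast, hHCδ]
    have h1 : H * δ ≤ s := by
      rw [← hHCδ]
      have := mul_le_mul_of_nonneg_left hC (mul_pos hH0 hδ0).le
      linarith
    have h2 : s ≤ ε / 4 := by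
      rw [← hHs]
      have := mul_le_mul_of_nonneg_right hH hs0.le
      linarith
    have h3 : ((H:ℝ) - 1) * (s + s) = ε / 2 - 2 * s := by
      have : ((H:ℝ) - 1) * (s + s) = 2 * (H * s) - 2 * s := by ring
      rw [this, hHs]; ring
    have h4 : 2 * (H:ℝ) * δ = 2 * (H * δ) := by ring
    rw [h3, h4]
    linarith
  · have haL : 1 ≤ a * L := by nlinarith
    have hCHε : C * H / ε ≤ Z := by
      rw [hZ]
      apply div_le_div_of_nonneg_right _ hε0.le
      have := mul_le_mul_of_nonneg_left haL (mul_pos hC0 hH0).le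
      linarith
    have hHZ : (H:ℝ) ≤ Z := by
      refine le_trans ?_ hCHε
      rw [le_div_iff₀ hε0]; nlinarith
    have hZ1 : 1 ≤ Z := hH.trans hHZ
    have hLZ : L ≤ Z := by
      rw [hZ, le_div_iff₀ hε0]
      have : 1 ≤ C * a * H := one_le_mul_of_one_le_of_one_le
        (one_le_mul_of_one_le_of_one_le hC (by linarith)) hH
      nlinarith
    have hqZ : 4 / q ^ 2 ≤ 256 * Z ^ 4 := by
      have e1 : 4 / q ^ 2 = 256 * ((C * H / ε) * H) ^ 2 := by rw [hq, hs]; field_simp; ring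
      rw [e1]
      have : (C * H / ε) * H ≤ Z * Z := mul_le_mul hCHε hHZ hH0.le (by linarith)
      calc _ ≤ 256 * (Z * Z) ^ 2 := by gcongr
        _ = _ := by ring
    have hb : L + 8 * H ^ 2 * C / ε ≤ 9 * Z ^ 2 := by
      have e1 : 8 * H ^ 2 * C / ε = 8 * ((C * H / ε) * H) := by ring
      have : (C * H / ε) * H ≤ Z * Z := mul_le_mul hCHε hHZ hH0.le (by linarith)
      rw [e1]; nlinarith
    have hrZ : r ≤ 2304 * Z ^ 6 := by
      calc r ≤ (256 * Z ^ 4) * (9 * Z ^ 2) := mul_le_mul hqZ hb (by positivity) (by positivity)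
        _ = _ := by ring
    have hnZ : (n:ℝ) ≤ 2305 * Z ^ 6 := by
      have := (Nat.ceil_lt_add_one hr0.le).le
      have h6 : 1 ≤ Z ^ 6 := one_le_pow₀ hZ1
      linarith
    have hc : (Xh.card : ℝ) ≤ H * n := by exact_mod_cast p7
    have e7 : Z ^ (7:ℝ) = Z ^ 7 := by exact_mod_cast Real.rpow_natCast Z 7
    rw [e7]
    calc (Xh.card : ℝ) ≤ H * n := hc
      _ ≤ Z * (2305 * Z ^ 6) := mul_le_mul hHZ hnZ (by positivity) (by linarith)
      _ = _ := by ring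
end

section
/- Recursive control of policy completeness errors under admissible resets: Let M be a finite-horizon layered MDP with horizon H, Π a policy class containing an optimal policy π⋆, and μ reset distributions such that every μ_h is admissible and μ satisfies concentrability with parameter C_conc with respect to Π̄. Let ε_stat ≥ 0 and suppose per-layer selections π̂_{h'} ∈ Π_{h'} satisfy the ε_stat-approximate policy optimization condition (CB_{h'}) with rollout π̂_{h'+1:H} for every layer h'. Then for every layer h and every admissible distribution ν on X_h: ε_PC(π̂_{h+1:H}, ν) ≤ (H − h)·C_conc·ε_stat + C_conc·Σ_{h'=h+1}^{H} ε_PC(π̂_{h'+1:H}). -/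
open Finset

set_option maxHeartbeats 2000000

namespace LayeredMDP

theorem aux_epsPC_le {X A : Type} [Fintype X] [Fintype A] [Nonempty A] {H : ℕ}
    (M : LayeredMDP X A H) (Pi : Finset (X → A)) (hPi : Pi.Nonempty) (ν : X → ℝ) (ρ π : X → A)
    (hπ : π ∈ Pi) : M.epsPC Pi hPi ν ρ ≤
      ∑ x, ν x * ((univ.sup' univ_nonempty fun a => M.Q ρ x a) - M.Q ρ x (π x)) := by
  unfold epsPC
  exact Finset.inf'_le (fun π : X → A =>
    ∑ x, ν x * ((univ.sup' univ_nonempty fun a => M.Q ρ x a) - M.Q ρ x (π x))) hπ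

theorem aux_sum_P {X A : Type} [Fintype X] [Fintype A] {H : ℕ} (M : LayeredMDP X A H)
    (x : X) (a : A) (n : ℕ) (hn : M.layer x + n = H) (f g : ℕ → X → ℝ)
    (h0 : ∀ x', f 0 x' = 0 ∧ g 0 x' = 0)
    (hfg : ∀ x', M.layer x' = M.layer x + 1 → f n x' ≤ g n x') :
    ∑ x', M.P x a x' * f n x' ≤ ∑ x', M.P x a x' * g n x' := by
  apply Finset.sum_le_sum
  intro x' _
  by_cases hP : M.P x a x' = 0
  · simp [hP]
  · rcases Nat.eq_zero_or_pos n with rfl | hpos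
    · rw [(h0 x').1, (h0 x').2]
    · exact mul_le_mul_of_nonneg_left (hfg x' (M.P_supp x a x' (by omega) hP)) (M.P_nonneg _ _ _)

theorem aux_Vsteps_congr {X A : Type} [Fintype X] [Fintype A] {H : ℕ} (M : LayeredMDP X A H)
    (π σ : X → A) (n : ℕ) : ∀ x, M.layer x + n = H + 1 →
      (∀ y, M.layer x ≤ M.layer y → π y = σ y) → Vsteps M π n x = Vsteps M σ n x := by
  induction n with
  | zero => intros; rfl
  | succ n ih =>
    intro x hx hy
    simp only [Vsteps]
    rw [hy x le_rfl]
    congr 1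
    apply le_antisymm
    · exact aux_sum_P M x _ n (by omega) (Vsteps M π) (Vsteps M σ) (fun _ => ⟨rfl, rfl⟩)
        fun x' h' => (ih x' (by omega) fun y hh => hy y (by omega)).le
    · exact aux_sum_P M x _ n (by omega) (Vsteps M σ) (Vsteps M π) (fun _ => ⟨rfl, rfl⟩)
        fun x' h' => (ih x' (by omega) fun y hh => hy y (by omega)).ge

theorem aux_V_eq {X A : Type} [Fintype X] [Fintype A] {H : ℕ} (M : LayeredMDP X A H)
    (π : X → A) (x : X) : M.V π x = M.Q π x (π x) := by
  have h := M.layer_ub x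
  have : H + 1 - M.layer x = (H - M.layer x) + 1 := by omega
  simp only [V, Q, this, Vsteps]

theorem aux_Q_le {X A : Type} [Fintype X] [Fintype A] {H : ℕ} (M : LayeredMDP X A H)
    (πs : X → A) (hopt : M.IsOptimal πs) (ρ : X → A) (x : X) (a : A) :
    M.Q ρ x a ≤ M.Q πs x (πs x) := by
  classical
  have hub := M.layer_ub x
  rw [← aux_V_eq]
  refine le_trans ?_ (hopt x (Function.update ρ x a))
  rw [aux_V_eq]
  simp only [Function.update_self, Q]
  apply add_le_add_right
  · apply aux_sum_P M x a (H - M.layer x) (by omega) (Vsteps M ρ)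
      (Vsteps M (Function.update ρ x a)) (fun _ => ⟨rfl, rfl⟩)
    intro x' h'
    have hub' := M.layer_ub x'
    apply le_of_eq
    apply aux_Vsteps_congr M _ _ _ _ (by omega)
    intro y hy
    rw [Function.update_of_ne]
    rintro rfl
    omega

theorem aux_occ_nonneg {X A : Type} [Fintype X] [Fintype A] {H : ℕ} (M : LayeredMDP X A H)
    (π : X → A) (n : ℕ) : ∀ x, 0 ≤ occAux M π n x := by
  induction n with
  | zero => exact M.d1_nonneg
  | succ n ih =>
    intro x
    exact Finset.sum_nonneg fun y _ => mul_nonneg (ih y) (M.P_nonneg _ _ _)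

theorem aux_occ_supp {X A : Type} [Fintype X] [Fintype A] {H : ℕ} (M : LayeredMDP X A H)
    (π : X → A) (n : ℕ) : n < H → ∀ x, occAux M π n x ≠ 0 → M.layer x = n + 1 := by
  induction n with
  | zero => intro _ x hx; exact M.d1_supp x hx
  | succ n ih =>
    intro hn x hx
    obtain ⟨y, _, hy⟩ := Finset.exists_ne_zero_of_sum_ne_zero hx
    have h1 := ih (by omega) y (left_ne_zero_of_mul hy)
    have h2 := M.P_supp y _ x (by omega) (right_ne_zero_of_mul hy)
    omega

theorem aux_occ_congr {X A : Type} [Fintype X] [Fintype A] {H : ℕ} (M : LayeredMDP X A H)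
    (π σ : X → A) (n : ℕ) : n < H → (∀ y, M.layer y ≤ n → π y = σ y) →
      occAux M π n = occAux M σ n := by
  induction n with
  | zero => intros; rfl
  | succ n ih =>
    intro hn hy
    funext x'
    simp only [occAux]
    have e := ih (by omega) fun y h => hy y (by omega)
    rw [e]
    apply Finset.sum_congr rfl
    intro x _
    by_cases h0 : occAux M σ n x = 0
    · simp [h0]
    · rw [hy x (aux_occ_supp M σ n (by omega) x h0).le]

theorem aux_occ_step {X A : Type} [Fintype X] [Fintype A] {H : ℕ} (M : LayeredMDP X A H)
    (π : X → A) (n : ℕ) (f : X → ℝ) :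
    ∑ x', occAux M π (n + 1) x' * f x' =
      ∑ x, occAux M π n x * ∑ x', M.P x (π x) x' * f x' := by
  simp only [occAux, Finset.sum_mul, Finset.mul_sum]
  rw [Finset.sum_comm]
  simp only [mul_assoc]

theorem aux_gap {X A : Type} [Fintype X] [Fintype A] {H : ℕ} (M : LayeredMDP X A H)
    (πs ρ π : X → A) (g : X → ℝ) (h : ℕ)
    (hπ : ∀ x, h < M.layer x → π x = πs x)
    (hg : ∀ x a, M.Q ρ x a - M.Q ρ x (ρ x) ≤ g x) (n : ℕ) :
    ∀ m, m + n = H → h ≤ m →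
    ∑ x, occAux M π m x * (Vsteps M πs n x - Vsteps M ρ n x) ≤
      ∑ k ∈ Finset.Icc (m + 1) H, ∑ x, occAux M π (k - 1) x * g x := by
  induction n with
  | zero =>
    intro m hm _
    rw [Finset.Icc_eq_empty (by omega)]
    simp [Vsteps]
  | succ n ih =>
    intro m hm hh
    have h1 := ih (m + 1) (by omega) (by omega)
    rw [aux_occ_step] at h1
    rw [← Finset.insert_Icc_add_one_left_eq_Icc (by omega : m + 1 ≤ H),
      Finset.sum_insert (by simp)]
    refine le_trans ?_ (add_le_add_right h1 _)
    rw [← Finset.sum_add_distrib]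
    apply Finset.sum_le_sum
    intro x _
    by_cases h0 : occAux M π m x = 0
    · simp [h0]
    · have hl := aux_occ_supp M π m (by omega) x h0
      rw [hπ x (by omega)]
      simp only [Nat.add_sub_cancel]
      rw [← mul_add]
      apply mul_le_mul_of_nonneg_left _ (aux_occ_nonneg M π m x)
      have := hg x (πs x)
      have e : H - M.layer x = n := by omega
      simp only [Q, e] at this
      simp only [Vsteps, mul_sub, Finset.sum_sub_distrib]
      linarith

end LayeredMDP

open LayeredMDP in
/-- Recursive control of policy completeness errors under admissible
resets: for every layer `h` and every admissible distribution `ν` on layer `h`,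
`ε_PC(π̂_{h+1:H}, ν) ≤ (H−h)·C_conc·ε_stat + C_conc·Σ_{h'=h+1}^{H} ε_PC(π̂_{h'+1:H})`. -/
theorem recursive_policy_completeness
    {X A : Type} [Fintype X] [Fintype A] [DecidableEq X] [Nonempty A]
    {H : ℕ} (M : LayeredMDP X A H)
    (Pi : Finset (X → A)) (hPi : Pi.Nonempty)
    (μ : ℕ → X → ℝ) (hμ : M.IsReset μ)
    (πs : X → A) (hopt : M.IsOptimal πs) (hreal : πs ∈ Pi)
    (Cconc : ℝ)
    (hconc : ∀ π, M.inClosure Pi π → ∀ h, 1 ≤ h → h ≤ H → ∀ x, M.layer x = h →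
      M.occ π h x ≤ Cconc * μ h x)
    (hadm : ∀ h, 1 ≤ h → h ≤ H → M.Admissible Pi h (μ h))
    (εstat : ℝ) (hεstat : 0 ≤ εstat)
    (pick : ℕ → X → A)
    (hmem : ∀ h, 1 ≤ h → h ≤ H → M.memLayer Pi h (pick h))
    (hCB : ∀ h, 1 ≤ h → h ≤ H →
      M.CB Pi (μ h) εstat (fun x => pick (M.layer x) x) (pick h)) :
    ∀ h, 1 ≤ h → h ≤ H → ∀ ν : X → ℝ, M.Admissible Pi h ν →
      M.epsPC Pi hPi ν (fun x => pick (M.layer x) x) ≤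
        ((H : ℝ) - (h : ℝ)) * Cconc * εstat +
          Cconc * ∑ h' ∈ Finset.Icc (h + 1) H,
            M.epsPC Pi hPi (μ h') (fun x => pick (M.layer x) x) := by
  intro h h1 hH ν hν
  set ρ : X → A := fun x => pick (M.layer x) x with hρ
  obtain ⟨hμ0, hμ1, hμs⟩ := hμ
  have hcl : M.inClosure Pi πs := fun k _ _ => ⟨πs, hreal, fun _ _ => rfl⟩
  have hC : 0 ≤ Cconc := by
    have e : ∑ x, M.d1 x ≤ ∑ x, Cconc * μ 1 x := by
      apply Finset.sum_le_sum
      intro x _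
      by_cases hx : M.layer x = 1
      · exact hconc πs hcl 1 le_rfl (by omega) x hx
      · have a1 : M.d1 x = 0 := by
          by_contra hc
          exact hx (M.d1_supp x hc)
        have a2 : μ 1 x = 0 := by
          by_contra hc
          exact hx (hμs 1 x le_rfl (by omega) hc)
        simp [a1, a2]
    rw [M.d1_sum_one, ← Finset.mul_sum, hμ1 1 le_rfl (by omega)] at e
    linarith
  set S : X → ℝ := fun x => univ.sup' univ_nonempty fun a => M.Q ρ x a with hS
  have hSle : ∀ x a, M.Q ρ x a ≤ S x := fun x a =>
    Finset.le_sup' (fun a => M.Q ρ x a) (Finset.mem_univ a)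
  have hSopt : ∀ x, S x ≤ M.Q πs x (πs x) := fun x =>
    Finset.sup'_le _ _ fun a _ => aux_Q_le M πs hopt ρ x a
  set g : X → ℝ := fun x => S x - M.Q ρ x (ρ x) with hgdef
  have hg0 : ∀ x, 0 ≤ g x := fun x => sub_nonneg.2 (hSle x _)
  have hμg : ∀ k, 1 ≤ k → k ≤ H → ∑ x, μ k x * g x ≤ εstat + M.epsPC Pi hPi (μ k) ρ := by
    intro k hk1 hk2
    rw [← sub_le_iff_le_add']
    unfold epsPC
    apply Finset.le_inf'
    intro π hπ
    have hcb := hCB k hk1 hk2 π hπ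
    have e : ∑ x, μ k x * M.Q ρ x (pick k x) = ∑ x, μ k x * M.Q ρ x (ρ x) := by
      apply Finset.sum_congr rfl
      intro x _
      by_cases h0 : μ k x = 0
      · simp [h0]
      · simp only [hρ, hμs k x hk1 hk2 h0]
    rw [e] at hcb
    change _ ≤ ∑ x, μ k x * (S x - M.Q ρ x (π x))
    simp only [hgdef, mul_sub, Finset.sum_sub_distrib]
    linarith
  have hkey : ∀ π, M.inClosure Pi π → ∑ x, M.occ π h x * (S x - M.Q ρ x (πs x)) ≤
      ((H : ℝ) - (h : ℝ)) * Cconc * εstat +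
          Cconc * ∑ h' ∈ Finset.Icc (h + 1) H, M.epsPC Pi hPi (μ h') ρ := by
    intro π hπ
    set σ : X → A := fun x => if M.layer x < h then π x else πs x with hσ
    have hσcl : M.inClosure Pi σ := by
      intro k hk1 hk2
      by_cases hk : k < h
      · obtain ⟨p, hp, hpx⟩ := hπ k hk1 hk2
        refine ⟨p, hp, fun x hx => ?_⟩
        simp only [hσ, hx, hk, if_true]
        exact hpx x hx
      · refine ⟨πs, hreal, fun x hx => ?_⟩
        simp only [hσ, hx, hk, if_false]
    have hocc : M.occ π h = occAux M σ (h - 1) := by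
      apply aux_occ_congr M _ _ _ (by omega)
      intro y hy
      have : M.layer y < h := by omega
      simp [hσ, this]
    rw [hocc]
    have s1 : ∑ x, occAux M σ (h - 1) x * (S x - M.Q ρ x (πs x)) ≤
        ∑ x, occAux M σ h x * (Vsteps M πs (H - h) x - Vsteps M ρ (H - h) x) := by
      obtain ⟨m, rfl⟩ : ∃ m, h = m + 1 := ⟨h - 1, by omega⟩
      rw [aux_occ_step]
      simp only [Nat.add_sub_cancel]
      apply Finset.sum_le_sum
      intro x _
      by_cases h0 : occAux M σ m x = 0
      · simp [h0]
      · have hl := aux_occ_supp M σ m (by omega) x h0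
        apply mul_le_mul_of_nonneg_left _ (aux_occ_nonneg M σ m x)
        have e : σ x = πs x := by simp [hσ, hl]
        have h2 := hSopt x
        rw [e]
        simp only [Q, hl] at h2 ⊢
        simp only [mul_sub, Finset.sum_sub_distrib]
        linarith
    have s2 := aux_gap M πs ρ σ g h (fun x hx => by
      have : ¬ M.layer x < h := by omega
      simp [hσ, this]) (fun x a => sub_le_sub_right (hSle x a) _) (H - h) h (by omega) le_rfl
    have s3 : ∑ k ∈ Finset.Icc (h + 1) H, ∑ x, occAux M σ (k - 1) x * g x ≤
        ∑ k ∈ Finset.Icc (h + 1) H, (Cconc * εstat + Cconc * M.epsPC Pi hPi (μ k) ρ) := by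
      apply Finset.sum_le_sum
      intro k hk
      rw [Finset.mem_Icc] at hk
      rw [← mul_add]
      refine le_trans ?_ (mul_le_mul_of_nonneg_left (hμg k (by omega) hk.2) hC)
      rw [Finset.mul_sum]
      apply Finset.sum_le_sum
      intro x _
      rw [← mul_assoc]
      apply mul_le_mul_of_nonneg_right _ (hg0 x)
      by_cases h0 : occAux M σ (k - 1) x = 0
      · rw [h0]
        exact mul_nonneg hC (hμ0 k x)
      · have hl := aux_occ_supp M σ (k - 1) (by omega) x h0
        exact hconc σ hσcl k (by omega) hk.2 x (by omega)
    refine (s1.trans s2).trans (s3.trans (le_of_eq ?_))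
    rw [Finset.sum_add_distrib, Finset.sum_const, Nat.card_Icc, ← Finset.mul_sum, nsmul_eq_mul,
      Nat.add_sub_add_right, Nat.cast_sub hH, mul_assoc]
  obtain ⟨w, hw0, hw1, hwc, hwν⟩ := hν
  have hle : M.epsPC Pi hPi ν ρ ≤ ∑ x, ν x * (S x - M.Q ρ x (πs x)) := by
    exact aux_epsPC_le M Pi hPi ν ρ πs hreal
  refine hle.trans ?_
  generalize ((H : ℝ) - (h : ℝ)) * Cconc * εstat +
          Cconc * ∑ h' ∈ Finset.Icc (h + 1) H, M.epsPC Pi hPi (μ h') ρ = B at hkey ⊢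
  have e : ∑ x, ν x * (S x - M.Q ρ x (πs x)) =
      ∑ π, w π * ∑ x, M.occ π h x * (S x - M.Q ρ x (πs x)) := by
    simp only [hwν, Finset.sum_mul, Finset.mul_sum]
    rw [Finset.sum_comm]
    simp only [mul_assoc]
  rw [e]
  calc _ ≤ ∑ π, w π * B := by
        apply Finset.sum_le_sum
        intro π _
        by_cases h0 : w π = 0
        · simp [h0]
        · exact mul_le_mul_of_nonneg_left (hkey π (hwc π h0)) (hw0 π)
    _ = B := by rw [← Finset.sum_mul, hw1, one_mul]
end
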